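/- arXiv:2309.04398 — 4 statements merged into one kernel-verified Lean document; each statement's English description precedes it below -/
import Mathlib

section
/- For every positive integer n, the sum of the minimal excludants over all overpartitions of n equals D_3(n), the number of partitions of n into distinct parts using three colors. Equivalently, the generating function Σ_{n≥0} σmex̄(n) q^n equals (−q;q)_∞^3. -/
noncomputable instance : TopologicalSpace (PowerSeries ℤ) :=
  inferInstanceAs (TopologicalSpace ((Unit →₀ ℕ) → ℤ))
noncomputable instance : TopologicalSpace (PowerSeries ℚ) :=
  inferInstanceAs (TopologicalSpace ((Unit →₀ ℕ) → ℚ))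

/-- An overpartition of `n`: a multiset of non-overlined positive parts together with a
finite set of overlined positive parts (at most one overlined copy per part size). -/
structure Overpartition (n : ℕ) where
  parts : Multiset ℕ              -- non-overlined parts
  overlined : Finset ℕ            -- overlined parts (distinct sizes)
  parts_pos : ∀ i ∈ parts, 0 < i
  overlined_pos : ∀ i ∈ overlined, 0 < i
  sum_eq : parts.sum + ∑ i ∈ overlined, i = n

/-- Minimal excludant of an overpartition: the least positive integer not among
the non-overlined parts. -/
noncomputable def Overpartition.mex {n : ℕ} (π : Overpartition n) : ℕ :=
  sInf {m : ℕ | 0 < m ∧ m ∉ π.parts}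

/-- Least `r`-gap: the least positive integer occurring fewer than `r` times among
the non-overlined parts. -/
noncomputable def Overpartition.rgap {n : ℕ} (r : ℕ) (π : Overpartition n) : ℕ :=
  sInf {m : ℕ | 0 < m ∧ π.parts.count m < r}

/-- `σmex̄(n)`: sum of minimal excludants over all overpartitions of `n`. -/
noncomputable def sigmaMex (n : ℕ) : ℕ := ∑ᶠ π : Overpartition n, π.mex

/-- `σ_r mex̄(n)`: sum of least `r`-gaps over all overpartitions of `n`. -/
noncomputable def sigmaRMex (r n : ℕ) : ℕ := ∑ᶠ π : Overpartition n, π.rgap r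

/-- `p̄(n)`: the number of overpartitions of `n`. -/
noncomputable def pbar (n : ℕ) : ℕ := Nat.card (Overpartition n)

open PowerSeries

/-- `D_3(n)`: the number of partitions of `n` into distinct parts using three colors. -/
noncomputable def D3 (n : ℕ) : ℕ :=
  Nat.card {t : Finset ℕ × Finset ℕ × Finset ℕ //
    (0 ∉ t.1 ∧ 0 ∉ t.2.1 ∧ 0 ∉ t.2.2) ∧
    ((∑ i ∈ t.1, i) + (∑ i ∈ t.2.1, i) + (∑ i ∈ t.2.2, i) = n)}


/-- Shanks' partial quotient. -/
def shG {R : Type*} [CommRing R] (q : R) (u : ℕ → R) (s n : ℕ) : R :=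
  ∏ k ∈ Finset.Ico s n, (1 - q ^ (2 * k + 2)) * u k

theorem shG_self {R : Type*} [CommRing R] (q : R) (u : ℕ → R) (n : ℕ) : shG q u n n = 1 := by
  simp [shG]

theorem shG_succ {R : Type*} [CommRing R] (q : R) (u : ℕ → R) (s n : ℕ) (h : s ≤ n) :
    shG q u s (n + 1) = shG q u s n * ((1 - q ^ (2 * n + 2)) * u n) := by
  simp [shG, Finset.prod_Ico_succ_top h]

theorem shG_left {R : Type*} [CommRing R] (q : R) (u : ℕ → R) (s n : ℕ) (h : s < n) :
    shG q u s n = ((1 - q ^ (2 * s + 2)) * u s) * shG q u (s + 1) n := by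
  simp [shG, Finset.prod_eq_prod_Ico_succ_bot h]

theorem shanks_aux {R : Type*} [CommRing R] (q : R) (u : ℕ → R)
    (hu : ∀ k, (1 - q ^ (2 * k + 1)) * u k = 1) (n m : ℕ) (h : m ≤ n) :
    ∑ s ∈ Finset.range (m + 1), (shG q u s (n + 1) * q ^ (s * (2 * n + 3))) =
    ∑ s ∈ Finset.range (m + 1), (shG q u s n * q ^ (s * (2 * n + 1))) +
      shG q u m n * q ^ ((m + 1) * (2 * n + 1)) * (1 - q ^ (2 * m + 1)) * u n := by
  induction m with
  | zero =>
    simp only [zero_add, Finset.sum_range_one, zero_mul, pow_zero, mul_one, one_mul, mul_zero,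
      pow_one]
    rw [shG_succ q u 0 n (by omega)]
    have := hu n
    linear_combination (shG q u 0 n) * this
  | succ m ih =>
    rw [Finset.sum_range_succ, ih (by omega), Finset.sum_range_succ _ (m + 1),
      shG_left q u m n (by omega), shG_succ q u (m + 1) n h]
    have h1 := hu n
    have h2 := hu m
    have e1 : q ^ ((m + 1) * (2 * n + 3)) = q ^ ((m + 1) * (2 * n + 1)) * q ^ (2 * m + 2) := by
      rw [← pow_add]; congr 1; ring
    have e2 : q ^ ((m + 1 + 1) * (2 * n + 1)) =
        q ^ ((m + 1) * (2 * n + 1)) * q ^ (2 * n + 1) := by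
      rw [← pow_add]; congr 1; ring
    have e3 : q ^ (2 * (m + 1) + 1) = q ^ (2 * m + 2) * q := by
      rw [← pow_succ]; congr 1
    have e4 : q ^ (2 * n + 2) = q ^ (2 * n + 1) * q := by
      rw [← pow_succ]
    rw [e1, e2, e3, e4]
    generalize q ^ ((m + 1) * (2 * n + 1)) = Y
    generalize shG q u (m + 1) n = G
    generalize q ^ (2 * m + 2) = M at *
    generalize q ^ (2 * n + 1) = N at *
    linear_combination (1 - M) * G * Y * u n * h2 + G * Y * h1

theorem shanks {R : Type*} [CommRing R] (q : R) (u : ℕ → R)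
    (hu : ∀ k, (1 - q ^ (2 * k + 1)) * u k = 1) (n : ℕ) :
    ∑ s ∈ Finset.range (n + 1), (shG q u s n * q ^ (s * (2 * n + 1))) =
    ∑ i ∈ Finset.range (2 * n + 1), q ^ (i * (i + 1) / 2) := by
  induction n with
  | zero => simp [shG]
  | succ n ih =>
    rw [Finset.sum_range_succ, show 2 * (n + 1) + 1 = 2 * n + 3 by ring,
      shanks_aux q u hu n n le_rfl, ih, shG_self, shG_self]
    rw [Finset.sum_range_succ _ (2 * n + 2), Finset.sum_range_succ _ (2 * n + 1)]
    have e1 : (2 * n + 1) * (2 * n + 1 + 1) / 2 = (n + 1) * (2 * n + 1) := by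
      apply Nat.div_eq_of_eq_mul_left (by norm_num); ring
    have e2 : (2 * n + 2) * (2 * n + 2 + 1) / 2 = (n + 1) * (2 * n + 3) := by
      apply Nat.div_eq_of_eq_mul_left (by norm_num); ring
    rw [e1, e2]
    linear_combination q ^ ((n + 1) * (2 * n + 1)) * hu n

/-- Shanks's identity with the denominator cleared. -/
theorem shanks_clear {R : Type*} [CommRing R] (q : R) (u : ℕ → R)
    (hu : ∀ k, (1 - q ^ (2 * k + 1)) * u k = 1) (n : ℕ) :
    ∃ r : R, (∑ i ∈ Finset.range (2 * n + 1), q ^ (i * (i + 1) / 2)) *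
      ∏ k ∈ Finset.range n, (1 - q ^ (2 * k + 1)) =
      ∏ k ∈ Finset.range n, (1 - q ^ (2 * k + 2)) + q ^ (2 * n + 1) * r := by
  refine ⟨(∑ s ∈ Finset.range n, (shG q u (s + 1) n * q ^ (s * (2 * n + 1)))) *
    ∏ k ∈ Finset.range n, (1 - q ^ (2 * k + 1)), ?_⟩
  rw [← shanks q u hu, Finset.sum_range_succ']
  have h0 : shG q u 0 n * ∏ k ∈ Finset.range n, (1 - q ^ (2 * k + 1)) =
      ∏ k ∈ Finset.range n, (1 - q ^ (2 * k + 2)) := by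
    rw [shG, Nat.Ico_zero_eq_range, ← Finset.prod_mul_distrib]
    refine Finset.prod_congr rfl fun k _ => ?_
    linear_combination (1 - q ^ (2 * k + 2)) * hu k
  have h1 : ∑ s ∈ Finset.range n, (shG q u (s + 1) n * q ^ ((s + 1) * (2 * n + 1))) =
      q ^ (2 * n + 1) * ∑ s ∈ Finset.range n, (shG q u (s + 1) n * q ^ (s * (2 * n + 1))) := by
    rw [Finset.mul_sum]
    refine Finset.sum_congr rfl fun k _ => ?_
    ring
  rw [h1, add_mul, zero_mul, pow_zero, mul_one, h0]
  ring

theorem prod_split {R : Type*} [CommRing R] (q : R) (n : ℕ) :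
    ∏ k ∈ Finset.range (2 * n), (1 - q ^ (k + 1)) =
      (∏ k ∈ Finset.range n, (1 - q ^ (2 * k + 2))) *
      ∏ k ∈ Finset.range n, (1 - q ^ (2 * k + 1)) := by
  induction n with
  | zero => simp
  | succ n ih =>
    rw [show 2 * (n + 1) = 2 * n + 1 + 1 by ring, Finset.prod_range_succ, Finset.prod_range_succ,
      ih, Finset.prod_range_succ _ n, Finset.prod_range_succ _ n]
    ring

theorem prod_even {R : Type*} [CommRing R] (q : R) (n : ℕ) :
    ∏ k ∈ Finset.range n, (1 - q ^ (2 * k + 2)) =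
      (∏ k ∈ Finset.range n, (1 - q ^ (k + 1))) * ∏ k ∈ Finset.range n, (1 + q ^ (k + 1)) := by
  rw [← Finset.prod_mul_distrib]
  refine Finset.prod_congr rfl fun k _ => ?_
  ring

/-- generic convolution -/
theorem card_conv {α β : Type*} (w : α → ℕ) (v : β → ℕ)
    (hw : ∀ n, Finite {a // w a = n}) (hv : ∀ n, Finite {b // v b = n}) (n : ℕ) :
    Finite {x : α × β // w x.1 + v x.2 = n} ∧
    Nat.card {x : α × β // w x.1 + v x.2 = n} =
      ∑ x ∈ Finset.HasAntidiagonal.antidiagonal n, Nat.card {a // w a = x.1} * Nat.card {b // v b = x.2} := by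
  let e : {x : α × β // w x.1 + v x.2 = n} ≃
      Σ x : Finset.HasAntidiagonal.antidiagonal n, {a // w a = x.1.1} × {b // v b = x.1.2} :=
    { toFun := fun x => ⟨⟨(w x.1.1, v x.1.2), by simpa using x.2⟩, ⟨x.1.1, rfl⟩, ⟨x.1.2, rfl⟩⟩
      invFun := fun y => ⟨(y.2.1.1, y.2.2.1), by
        have := y.1.2
        rw [Finset.HasAntidiagonal.mem_antidiagonal] at this
        rw [y.2.1.2, y.2.2.2, this]⟩
      left_inv := fun x => rfl
      right_inv := by
        have key : ∀ (a b : ℕ) (h : (a, b) ∈ Finset.HasAntidiagonal.antidiagonal n)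
            (x : {x // w x = a}) (y : {y // v y = b}) (h'),
            (⟨⟨(w x.1, v y.1), h'⟩, ⟨x.1, rfl⟩, ⟨y.1, rfl⟩⟩ :
              Σ x : Finset.HasAntidiagonal.antidiagonal n,
                {a // w a = x.1.1} × {b // v b = x.1.2}) = ⟨⟨(a, b), h⟩, x, y⟩ := by
          rintro _ _ h ⟨x, rfl⟩ ⟨y, rfl⟩ _
          rfl
        exact fun z => key z.1.1.1 z.1.1.2 z.1.2 z.2.1 z.2.2 _ }
  refine ⟨Finite.of_equiv _ e.symm, ?_⟩
  rw [Nat.card_congr e, Nat.card_sigma]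
  simp only [Nat.card_prod]
  exact Finset.sum_coe_sort (Finset.HasAntidiagonal.antidiagonal n)
    (fun x => Nat.card {a // w a = x.1} * Nat.card {b // v b = x.2})

abbrev PM := {s : Multiset ℕ // ∀ i ∈ s, 0 < i}
abbrev FS := {s : Finset ℕ // 0 ∉ s}
def wPM (s : PM) : ℕ := s.1.sum
def wFS (s : FS) : ℕ := ∑ i ∈ s.1, i

def ePM (n : ℕ) : {a : PM // wPM a = n} ≃ Nat.Partition n where
  toFun a := ⟨a.1.1, fun {i} h => a.1.2 i h, a.2⟩
  invFun p := ⟨⟨p.parts, fun _ h => p.parts_pos h⟩, p.parts_sum⟩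
  left_inv _ := rfl
  right_inv _ := rfl

def eFS (n : ℕ) : {a : FS // wFS a = n} ≃ {p : Nat.Partition n // p ∈ Nat.Partition.distincts n} where
  toFun a := ⟨⟨a.1.1.1, fun {i} h => Nat.pos_of_ne_zero fun h0 => a.1.2 (h0 ▸ h), by
    have := a.2; simpa only [wFS, Finset.sum, Multiset.map_id'] using this⟩, by
    simpa [Nat.Partition.distincts] using a.1.1.2⟩
  invFun p := ⟨⟨⟨p.1.parts, by simpa [Nat.Partition.distincts] using p.2⟩, fun h => by
    have := p.1.parts_pos h; omega⟩, by simpa only [wFS, Finset.sum, Multiset.map_id'] using p.1.parts_sum⟩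
  left_inv _ := rfl
  right_inv _ := rfl

instance finPM (n : ℕ) : Finite {a : PM // wPM a = n} := Finite.of_equiv _ (ePM n).symm
instance finFS (n : ℕ) : Finite {a : FS // wFS a = n} := Finite.of_equiv _ (eFS n).symm

def eOv (n : ℕ) : Overpartition n ≃ {x : PM × FS // wPM x.1 + wFS x.2 = n} where
  toFun π := ⟨(⟨π.parts, π.parts_pos⟩, ⟨π.overlined, fun h => by
    have := π.overlined_pos 0 h; omega⟩), π.sum_eq⟩
  invFun x := ⟨x.1.1.1, x.1.2.1, x.1.1.2, fun i h => Nat.pos_of_ne_zero fun h0 =>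
    x.1.2.2 (h0 ▸ h), x.2⟩
  left_inv _ := rfl
  right_inv _ := rfl

instance finOv (n : ℕ) : Finite (Overpartition n) := by
  have := (card_conv wPM wFS finPM finFS n).1
  exact Finite.of_equiv _ (eOv n).symm

noncomputable def Pgf : PowerSeries ℤ := PowerSeries.mk fun n => (Nat.card {a : PM // wPM a = n} : ℤ)
noncomputable def Dgf : PowerSeries ℤ := PowerSeries.mk fun n => (Nat.card {a : FS // wFS a = n} : ℤ)

theorem pbar_gf (n : ℕ) : (pbar n : ℤ) = (Pgf * Dgf).coeff n := by
  rw [pbar, Nat.card_congr (eOv n), (card_conv wPM wFS finPM finFS n).2, PowerSeries.coeff_mul]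
  simp [Pgf, Dgf]

theorem D3_gf (n : ℕ) : (D3 n : ℤ) = (Dgf ^ 3).coeff n := by
  have h2 := card_conv wFS wFS finFS finFS
  have h3 := card_conv wFS (fun x : FS × FS => wFS x.1 + wFS x.2) finFS (fun n => (h2 n).1) n
  have e : {t : Finset ℕ × Finset ℕ × Finset ℕ //
    (0 ∉ t.1 ∧ 0 ∉ t.2.1 ∧ 0 ∉ t.2.2) ∧
    ((∑ i ∈ t.1, i) + (∑ i ∈ t.2.1, i) + (∑ i ∈ t.2.2, i) = n)} ≃
    {x : FS × FS × FS // wFS x.1 + (wFS x.2.1 + wFS x.2.2) = n} :=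
    { toFun := fun t => ⟨(⟨t.1.1, t.2.1.1⟩, ⟨t.1.2.1, t.2.1.2.1⟩, ⟨t.1.2.2, t.2.1.2.2⟩), by
        have := t.2.2
        simp only [wFS]; omega⟩
      invFun := fun x => ⟨(x.1.1.1, x.1.2.1.1, x.1.2.2.1), ⟨x.1.1.2, x.1.2.1.2, x.1.2.2.2⟩, by
        have := x.2
        simp only [wFS] at this ⊢; omega⟩
      left_inv := fun _ => rfl
      right_inv := fun _ => rfl }
  rw [D3, Nat.card_congr e, h3.2, pow_succ', pow_two, PowerSeries.coeff_mul]
  push_cast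
  refine Finset.sum_congr rfl fun x _ => ?_
  rw [(h2 _).2, PowerSeries.coeff_mul]
  simp [Dgf]

/-- The multiset `{1, …, m}`. -/
def stair (m : ℕ) : Multiset ℕ := (Finset.Icc 1 m).1

theorem stair_sum (m : ℕ) : (stair m).sum = m * (m + 1) / 2 := by
  have h : (stair m).sum * 2 = m * (m + 1) := by
    induction m with
    | zero => simp [stair]
    | succ m ih =>
      have : (stair (m + 1)).sum = (stair m).sum + (m + 1) := by
        have := Finset.sum_Icc_succ_top (show 1 ≤ m + 1 by omega) (fun i : ℕ => i)
        simpa only [stair, Finset.sum, Multiset.map_id'] using this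
      rw [this, add_mul, ih]; ring
  omega

theorem stair_le_iff (m : ℕ) (s : Multiset ℕ) :
    stair m ≤ s ↔ ∀ i, 0 < i → i ≤ m → i ∈ s := by
  rw [stair, Multiset.le_iff_subset (Finset.nodup _)]
  constructor
  · intro h i h1 h2
    exact h (by simp; omega)
  · intro h i hi
    simp at hi
    exact h i (by omega) (by omega)

theorem mex_eq {n : ℕ} (π : Overpartition n) :
    π.mex = ∑ m ∈ Finset.range (n + 1), if stair m ≤ π.parts then 1 else 0 := by
  have hle : ∀ i ∈ π.parts, i ≤ n := fun i hi => by
    have := Multiset.le_sum_of_mem hi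
    have := π.sum_eq
    omega
  have hne : (n + 1) ∈ {m : ℕ | 0 < m ∧ m ∉ π.parts} :=
    ⟨by omega, fun h => by have := hle _ h; omega⟩
  have h1 : π.mex ∈ {m : ℕ | 0 < m ∧ m ∉ π.parts} := Nat.sInf_mem ⟨_, hne⟩
  have h2 : π.mex ≤ n + 1 := Nat.sInf_le hne
  have h3 : ∀ i, 0 < i → i < π.mex → i ∈ π.parts := fun i hi hlt => by
    by_contra hc
    have : π.mex ≤ i := Nat.sInf_le ⟨hi, hc⟩
    omega
  rw [← Finset.sum_filter, Finset.sum_const, smul_eq_mul, mul_one]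
  have : (Finset.range (n + 1)).filter (fun m => stair m ≤ π.parts) = Finset.range π.mex := by
    ext m
    simp only [Finset.mem_filter, Finset.mem_range, stair_le_iff]
    constructor
    · rintro ⟨_, h⟩
      by_contra hc
      exact h1.2 (h _ h1.1 (by omega))
    · intro h
      exact ⟨by omega, fun i hi hi2 => h3 i hi (by omega)⟩
  rw [this, Finset.card_range]

theorem card_stair (n m : ℕ) :
    Nat.card {π : Overpartition n // stair m ≤ π.parts} =
      if m * (m + 1) / 2 ≤ n then pbar (n - m * (m + 1) / 2) else 0 := by
  rw [← stair_sum]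
  split_ifs with h
  · rw [pbar]
    refine Nat.card_congr
      { toFun := fun π => ⟨π.1.parts - stair m, π.1.overlined,
          fun i hi => π.1.parts_pos i (Multiset.mem_of_le (Multiset.sub_le_self _ _) hi),
          π.1.overlined_pos, ?_⟩
        invFun := fun π => ⟨⟨π.parts + stair m, π.overlined, ?_, π.overlined_pos, ?_⟩, ?_⟩
        left_inv := ?_
        right_inv := ?_ }
    · have h1 := π.1.sum_eq
      have h2 : (π.1.parts - stair m).sum + (stair m).sum = π.1.parts.sum := by
        rw [← Multiset.sum_add, Multiset.sub_add_cancel π.2]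
      omega
    · intro i hi
      rcases Multiset.mem_add.1 hi with hi | hi
      · exact π.parts_pos i hi
      · simp [stair] at hi; omega
    · have := π.sum_eq
      rw [Multiset.sum_add]; omega
    · exact Multiset.le_add_left _ _
    · rintro ⟨⟨p, o, a, b, c⟩, hp⟩
      simp only [Subtype.mk.injEq, Overpartition.mk.injEq, and_true]
      exact Multiset.sub_add_cancel hp
    · rintro ⟨p, o, a, b, c⟩
      simp
  · rw [Nat.card_eq_zero]
    left
    refine ⟨fun π => h ?_⟩
    obtain ⟨t, ht⟩ := Multiset.le_iff_exists_add.1 π.2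
    have := π.1.sum_eq
    rw [ht, Multiset.sum_add] at this
    omega

theorem sigmaMex_eq (n : ℕ) : sigmaMex n =
    ∑ m ∈ Finset.range (n + 1), if m * (m + 1) / 2 ≤ n then pbar (n - m * (m + 1) / 2) else 0 := by
  classical
  have := Fintype.ofFinite (Overpartition n)
  rw [sigmaMex, finsum_eq_sum_of_fintype]
  simp only [mex_eq]
  rw [Finset.sum_comm]
  refine Finset.sum_congr rfl fun m _ => ?_
  rw [← card_stair, Nat.card_eq_fintype_card, Fintype.card_subtype, Finset.sum_boole, Nat.cast_id]

theorem sigmaMex_coeff (n k : ℕ) (hk : n < k) : (sigmaMex n : ℤ) =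
    ((∑ m ∈ Finset.range k, (PowerSeries.X : PowerSeries ℤ) ^ (m * (m + 1) / 2)) *
      (Pgf * Dgf)).coeff n := by
  rw [sigmaMex_eq, Finset.sum_mul, map_sum]
  push_cast
  rw [← Finset.sum_range_add_sum_Ico _ (show n + 1 ≤ k from hk)]
  rw [Finset.sum_eq_zero (s := Finset.Ico (n + 1) k), add_zero]
  · refine Finset.sum_congr rfl fun m _ => ?_
    rw [PowerSeries.coeff_X_pow_mul', pbar_gf]
  · intro m hm
    rw [PowerSeries.coeff_X_pow_mul', if_neg]
    rw [Finset.mem_Ico] at hm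
    have : m ≤ m * (m + 1) / 2 := by
      rw [Nat.le_div_iff_mul_le (by norm_num)]
      exact Nat.mul_le_mul le_rfl (by omega)
    omega

section analytic
open Filter Topology
open scoped PowerSeries.WithPiTopology

/-- Inside this section Mathlib's (definitionally equal) topology is preferred. -/
local instance piTopInt : TopologicalSpace (PowerSeries ℤ) :=
  PowerSeries.WithPiTopology.instTopologicalSpace ℤ

theorem hasProd_D : HasProd (fun k : ℕ => (1 + (X : PowerSeries ℤ) ^ (k + 1))) Dgf := by
  have h := Nat.Partition.hasProd_powerSeriesMk_card_countRestricted ℤ (m := 2) (by norm_num)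
  have e : (PowerSeries.mk fun n => ((Nat.Partition.countRestricted n 2).card : ℤ)) = Dgf := by
    ext n
    rw [Dgf, PowerSeries.coeff_mk, PowerSeries.coeff_mk, Nat.card_congr (eFS n),
      Nat.Partition.countRestricted_two]
    simp
  rw [e] at h
  simpa [Finset.sum_range_succ] using h

theorem P_mul_Q : Pgf * ∏' k : ℕ, (1 - (X : PowerSeries ℤ) ^ (k + 1)) = 1 := by
  have h := Nat.Partition.hasProd_powerSeriesMk_card_restricted ℤ (fun _ => True)
  have e : (PowerSeries.mk fun n => ((Nat.Partition.restricted n (fun _ => True)).card : ℤ))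
      = Pgf := by
    ext n
    rw [Pgf, PowerSeries.coeff_mk, PowerSeries.coeff_mk, Nat.card_congr (ePM n)]
    simp [Nat.Partition.restricted]
  rw [e] at h
  have h2 := h.mul (WithPiTopology.multipliable_one_sub_X_pow ℤ).hasProd
  have h3 : (fun i : ℕ => (if True then ∑' j : ℕ, (X : PowerSeries ℤ) ^ ((i + 1) * j) else 1) *
      (1 - X ^ (i + 1))) = fun _ => 1 := by
    funext i
    simp only [if_true, pow_mul]
    exact WithPiTopology.tsum_pow_mul_one_sub_of_constantCoeff_eq_zero (by simp)
  exact (h3 ▸ h2 :).unique hasProd_one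

theorem multipliable_odd : Multipliable fun k : ℕ => (1 - (X : PowerSeries ℤ) ^ (2 * k + 1)) := by
  simp_rw [sub_eq_add_neg]
  apply WithPiTopology.multipliable_one_add_of_tendsto_order_atTop_nhds_top
  refine ENat.tendsto_nhds_top_iff_natCast_lt.mpr (fun n ↦ Filter.eventually_atTop.mpr ⟨n, ?_⟩)
  intro m hm
  rw [order_neg, order_X_pow]
  norm_cast
  omega

theorem main_gf : PowerSeries.mk (fun n => (sigmaMex n : ℤ)) = Dgf ^ 3 := by
  set A := PowerSeries.mk (fun n => (sigmaMex n : ℤ)) with hA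
  set Q := ∏' k : ℕ, (1 - (X : PowerSeries ℤ) ^ (k + 1)) with hQ
  set O := ∏' k : ℕ, (1 - (X : PowerSeries ℤ) ^ (2 * k + 1)) with hO
  have tQ : Tendsto (fun n => ∏ k ∈ Finset.range n, (1 - (X : PowerSeries ℤ) ^ (k + 1)))
      atTop (𝓝 Q) := (WithPiTopology.multipliable_one_sub_X_pow ℤ).hasProd.tendsto_prod_nat
  have tO : Tendsto (fun n => ∏ k ∈ Finset.range n, (1 - (X : PowerSeries ℤ) ^ (2 * k + 1)))
      atTop (𝓝 O) := multipliable_odd.hasProd.tendsto_prod_nat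
  have tD : Tendsto (fun n => ∏ k ∈ Finset.range n, (1 + (X : PowerSeries ℤ) ^ (k + 1)))
      atTop (𝓝 Dgf) := hasProd_D.tendsto_prod_nat
  have tE : Tendsto (fun n => ∏ k ∈ Finset.range n, (1 - (X : PowerSeries ℤ) ^ (2 * k + 2)))
      atTop (𝓝 (Q * Dgf)) := by
    simp_rw [prod_even]
    exact tQ.mul tD
  have PQ : Pgf * Q = 1 := P_mul_Q
  have hQO : Q = Q * Dgf * O := by
    have t1 := tE.mul tO
    simp_rw [← prod_split] at t1
    have t2 : Tendsto (fun n : ℕ => 2 * n) atTop atTop :=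
      tendsto_atTop_mono (fun n => by simp only [id]; omega) tendsto_id
    exact tendsto_nhds_unique (tQ.comp t2) t1
  have hDO : Dgf * O = 1 := by
    linear_combination (1 - Dgf * O) * PQ - Pgf * hQO
  have hu : ∀ k : ℕ, ∃ u : PowerSeries ℤ, (1 - (X : PowerSeries ℤ) ^ (2 * k + 1)) * u = 1 := by
    intro k
    have : IsUnit (1 - (X : PowerSeries ℤ) ^ (2 * k + 1)) := by
      rw [PowerSeries.isUnit_iff_constantCoeff]
      simp
    exact this.exists_right_inv
  choose u hu using hu
  choose r hr using shanks_clear (X : PowerSeries ℤ) u hu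
  have tA : Tendsto (fun n => (∑ m ∈ Finset.range (2 * n + 1),
      (X : PowerSeries ℤ) ^ (m * (m + 1) / 2)) * (Pgf * Dgf)) atTop (𝓝 A) := by
    rw [WithPiTopology.tendsto_iff_coeff_tendsto]
    intro d
    refine tendsto_atTop_of_eventually_const (i₀ := d) fun n hn => ?_
    rw [hA, PowerSeries.coeff_mk]
    exact (sigmaMex_coeff d _ (by omega)).symm
  have tR : Tendsto (fun n => (X : PowerSeries ℤ) ^ (2 * n + 1) * r n) atTop (𝓝 0) := by
    rw [WithPiTopology.tendsto_iff_coeff_tendsto]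
    intro d
    refine tendsto_atTop_of_eventually_const (i₀ := d) fun n hn => ?_
    rw [PowerSeries.coeff_X_pow_mul', if_neg (by omega), map_zero]
  have hAO : A * O = (Q * Dgf + 0) * (Pgf * Dgf) := by
    refine tendsto_nhds_unique (tA.mul tO) (((tE.add tR).mul_const (Pgf * Dgf)).congr fun n => ?_)
    rw [← hr]
    ring
  linear_combination (-A) * hDO + Dgf * hAO + Dgf ^ 3 * PQ

end analytic

/-- σmex̄(n) = D₃(n) for all positive `n`; equivalently, the generating function of
σmex̄ is (−q;q)_∞³. -/
theorem stmt2 :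
    (∀ n : ℕ, 0 < n → sigmaMex n = D3 n) ∧
    PowerSeries.mk (fun n => (sigmaMex n : ℤ))
      = (∏' k : ℕ, (1 + (X : PowerSeries ℤ) ^ (k + 1))) ^ 3 := by
  have hD : ∏' k : ℕ, (1 + (X : PowerSeries ℤ) ^ (k + 1)) = Dgf :=
    by
    have : T2Space (PowerSeries ℤ) := PowerSeries.WithPiTopology.instT2Space ℤ
    exact HasProd.tprod_eq hasProd_D
  refine ⟨fun n _ => ?_, ?_⟩
  · have h := congrArg (PowerSeries.coeff n) main_gf
    rw [PowerSeries.coeff_mk, ← D3_gf] at h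
    exact_mod_cast h
  · rw [hD, main_gf]
end

section
/- For every positive integer r, the generating function Σ_{n≥0} σ_r mex̄(n) q^n = (−q;q)_∞ (q^{2r};q^{2r})_∞ / [(q;q)_∞ (q^r;q^{2r})_∞]. -/
open PowerSeries


namespace OverGap

/-- Shanks's finite form of Gauss's triangular number identity. -/
theorem shanks {R : Type*} [CommRing R] (q : R) (u g P : ℕ → R)
    (hu : ∀ n, u n * (1 - q ^ (2 * n + 1)) = 1)
    (hP : ∀ n, P (n + 1) = P n * (1 - q ^ (2 * n + 2)) * u n)
    (hg : ∀ s, g (s + 1) * (1 - q ^ (2 * s + 2)) = g s * (1 - q ^ (2 * s + 1)))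
    (hPg : ∀ n, P n * g n = 1) (n : ℕ) :
    ∑ s ∈ Finset.range (2 * n), q ^ (s * (s + 1) / 2)
      = P n * ∑ s ∈ Finset.range n, g s * q ^ (s * (2 * n + 1)) := by
  induction n with
  | zero => simp
  | succ n ih =>
    have tel : ∀ m, ∑ s ∈ Finset.range m, g s * q ^ (s * (2 * n + 1)) *
        (q ^ (2 * s) * (1 - q ^ (2 * n + 2)) - (1 - q ^ (2 * n + 1)))
        = g m * (1 - q ^ (2 * m)) * q ^ (m * (2 * n + 1)) := by
      intro m
      induction m with
      | zero => simp
      | succ m ihm =>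
        rw [Finset.sum_range_succ, ihm]
        have := hg m
        have e : q ^ ((m + 1) * (2 * n + 1)) = q ^ (m * (2 * n + 1)) * q ^ (2 * n + 1) := by ring
        rw [e, show 2 * (m + 1) = 2 * m + 2 by ring, this]
        ring
    have h1 : (2 * n) * (2 * n + 1) / 2 = n * (2 * n + 1) := by
      rw [mul_assoc]; exact Nat.mul_div_cancel_left _ (by norm_num)
    have h2 : (2 * n + 1) * (2 * n + 1 + 1) / 2 = (n + 1) * (2 * n + 1) := by
      rw [show (2 * n + 1) * (2 * n + 1 + 1) = 2 * ((n + 1) * (2 * n + 1)) by ring]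
      exact Nat.mul_div_cancel_left _ (by norm_num)
    have hcancel : ∀ a b : R, a * (1 - q ^ (2 * n + 1)) = b * (1 - q ^ (2 * n + 1)) → a = b := by
      intro a b hab
      calc a = a * (1 - q ^ (2 * n + 1)) * u n := by rw [mul_assoc, mul_comm _ (u n), hu, mul_one]
        _ = b * (1 - q ^ (2 * n + 1)) * u n := by rw [hab]
        _ = b := by rw [mul_assoc, mul_comm _ (u n), hu, mul_one]
    rw [show 2 * (n + 1) = 2 * n + 1 + 1 by ring, Finset.sum_range_succ, Finset.sum_range_succ, ih,
      h1, h2, Finset.sum_range_succ, hP]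
    apply hcancel
    have T := tel n
    have hs : ∑ s ∈ Finset.range n, g s * q ^ (s * (2 * n + 1)) *
        (q ^ (2 * s) * (1 - q ^ (2 * n + 2)) - (1 - q ^ (2 * n + 1)))
        = (1 - q ^ (2 * n + 2)) * ∑ s ∈ Finset.range n, g s * q ^ (s * (2 * n + 1 + 1 + 1))
          - (1 - q ^ (2 * n + 1)) * ∑ s ∈ Finset.range n, g s * q ^ (s * (2 * n + 1)) := by
      rw [Finset.mul_sum, Finset.mul_sum, ← Finset.sum_sub_distrib]
      refine Finset.sum_congr rfl fun s _ => ?_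
      ring
    rw [hs] at T
    generalize ∑ s ∈ Finset.range n, g s * q ^ (s * (2 * n + 1 + 1 + 1)) = A at *
    generalize ∑ s ∈ Finset.range n, g s * q ^ (s * (2 * n + 1)) = B at *
    have e2 := hPg n
    have e3 := hu n
    have x1 : q ^ (n * (2 * n + 1 + 1 + 1)) = q ^ (n * (2 * n + 1)) * q ^ (2 * n) := by ring
    have x2 : q ^ ((n + 1) * (2 * n + 1)) = q ^ (n * (2 * n + 1)) * q ^ (2 * n + 1) := by ring
    rw [x1, x2]
    have y1 : q ^ (2 * n + 2) = q ^ (2 * n) * q ^ 2 := by ring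
    have y2 : q ^ (2 * n + 1) = q ^ (2 * n) * q := by ring
    rw [y1, y2] at T
    rw [y2] at e3
    rw [y1, y2]
    clear x1 x2 y1 y2
    generalize q ^ (n * (2 * n + 1)) = Z at *
    generalize q ^ (2 * n) = W at *
    generalize u n = U at *
    generalize g n = G at *
    generalize P n = p at *
    linear_combination (-p) * T - (1 - W * q ^ 2) * p * (A + G * Z * W) * e3
      - Z * (1 - W) * e2 - Z * W * (1 - W * q ^ 2) * e2

/-- Overpartitions as pairs (partition, distinct partition). -/
noncomputable def overEquiv (n : ℕ) : Overpartition n ≃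
    Σ p : Finset.HasAntidiagonal.antidiagonal n, p.1.1.Partition × Nat.Partition.distincts p.1.2 where
  toFun π := ⟨⟨(π.parts.sum, ∑ i ∈ π.overlined, i), by simpa using π.sum_eq⟩,
    ⟨π.parts, fun {i} h => π.parts_pos i h, rfl⟩,
    ⟨⟨π.overlined.val, fun {i} h => π.overlined_pos i h, by simp only [Finset.sum, Multiset.map_id']⟩,
      by simpa [Nat.Partition.distincts] using π.overlined.nodup⟩⟩
  invFun x := ⟨x.2.1.parts, ⟨x.2.2.1.parts, by
      exact (Finset.mem_filter.mp x.2.2.2).2⟩,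
    fun i h => x.2.1.parts_pos h, fun i h => x.2.2.1.parts_pos h, by
      have h1 := x.2.1.parts_sum
      have h2 := x.2.2.1.parts_sum
      have h3 := x.1.2
      rw [Finset.HasAntidiagonal.mem_antidiagonal] at h3
      simp only [Finset.sum, Multiset.map_id']
      omega⟩
  left_inv π := rfl
  right_inv := by
    rintro ⟨⟨⟨a, b⟩, hab⟩, ⟨p, hp, h1⟩, ⟨⟨c, hc, h2⟩, hd⟩⟩
    have h1' : p.sum = a := h1
    have h2' : c.sum = b := h2
    subst h1' h2'
    have h3 : ∀ (h : c.Nodup), ∑ i ∈ (⟨c, h⟩ : Finset ℕ), i = c.sum := by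
      intro h
      simp only [Finset.sum, Multiset.map_id']
    have hgen : ∀ (b : ℕ) (hb : b = c.sum) (hab' : (p.sum, b) ∈ Finset.HasAntidiagonal.antidiagonal n)
        (h2' : c.sum = b) (hd' : (⟨c, hc, h2'⟩ : b.Partition) ∈ Nat.Partition.distincts b),
        (⟨⟨(p.sum, b), hab'⟩, ⟨p, hp, rfl⟩, ⟨⟨c, hc, h2'⟩, hd'⟩⟩ :
          Σ p : Finset.HasAntidiagonal.antidiagonal n,
            p.1.1.Partition × Nat.Partition.distincts p.1.2)
        = ⟨⟨(p.sum, c.sum), hab⟩, ⟨p, hp, h1⟩, ⟨⟨c, hc, h2⟩, hd⟩⟩ := by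
      intro b hb
      subst hb
      intros
      rfl
    exact hgen _ (h3 (Finset.mem_filter.mp hd).2) _ _ _

noncomputable instance (n : ℕ) : Fintype (Overpartition n) := Fintype.ofEquiv _ (overEquiv n).symm

theorem pbar_eq (n : ℕ) : pbar n = ∑ p ∈ Finset.HasAntidiagonal.antidiagonal n,
    Fintype.card p.1.Partition * (Nat.Partition.distincts p.2).card := by
  rw [pbar, Nat.card_congr (overEquiv n), Nat.card_eq_fintype_card, Fintype.card_sigma,
    ← Finset.sum_coe_sort (Finset.HasAntidiagonal.antidiagonal n)]
  simp

def stair (r k : ℕ) : Multiset ℕ := r • (Finset.Icc 1 k).val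

theorem stair_sum (r k : ℕ) : (stair r k).sum = r * (k * (k + 1) / 2) := by
  have : ∑ i ∈ Finset.Icc 1 k, i = k * (k + 1) / 2 := by
    have h := Finset.sum_range_id (k + 1)
    rw [Finset.range_eq_Ico, Finset.sum_eq_sum_Ico_succ_bot (by omega)] at h
    rw [Nat.add_sub_cancel, zero_add, zero_add] at h
    rw [mul_comm k, ← h]
    rfl
  rw [stair, Multiset.sum_nsmul, smul_eq_mul, ← this]
  simp only [Finset.sum, Multiset.map_id']

theorem stair_le (r k : ℕ) (s : Multiset ℕ) :
    stair r k ≤ s ↔ ∀ i, 1 ≤ i → i ≤ k → r ≤ s.count i := by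
  rw [Multiset.le_iff_count]
  refine forall_congr' fun i => ?_
  rw [stair, Multiset.count_nsmul, Multiset.count_eq_of_nodup (Finset.nodup _)]
  simp only [Finset.mem_val, Finset.mem_Icc]
  split_ifs with h
  · simp [h]
  · simp; omega

theorem lt_rgap_iff {n : ℕ} (r : ℕ) (hr : 1 ≤ r) (π : Overpartition n) (k : ℕ) :
    k < π.rgap r ↔ stair r k ≤ π.parts := by
  rw [stair_le]
  have hne : {m : ℕ | 0 < m ∧ π.parts.count m < r}.Nonempty := by
    refine ⟨n + 1, by omega, ?_⟩
    rw [Multiset.count_eq_zero_of_notMem]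
    · omega
    · intro h
      have := Multiset.le_sum_of_mem h
      have := π.sum_eq
      omega
  have hmem := Nat.sInf_mem hne
  constructor
  · intro h i h1 h2
    by_contra hc
    have := Nat.sInf_le (s := {m : ℕ | 0 < m ∧ π.parts.count m < r}) ⟨h1, not_le.mp hc⟩
    simp only [Overpartition.rgap] at h
    omega
  · intro h
    by_contra hc
    have := h _ hmem.1 (not_lt.mp hc)
    exact absurd hmem.2 (not_lt.mpr this)

theorem rgap_le {n : ℕ} (r : ℕ) (hr : 1 ≤ r) (π : Overpartition n) : π.rgap r ≤ n + 1 := by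
  refine Nat.sInf_le ⟨by omega, ?_⟩
  rw [Multiset.count_eq_zero_of_notMem]
  · omega
  · intro h
    have := Multiset.le_sum_of_mem h
    have := π.sum_eq
    omega

/-- Removing a fixed multiset of parts. -/
def shiftEquiv (S : Multiset ℕ) (hS : ∀ i ∈ S, 0 < i) (m : ℕ) :
    {π : Overpartition (m + S.sum) // S ≤ π.parts} ≃ Overpartition m where
  toFun π := ⟨π.1.parts - S, π.1.overlined,
    fun i h => π.1.parts_pos i (Multiset.mem_of_le (Multiset.sub_le_self _ _) h),
    π.1.overlined_pos, by
      have h := π.1.sum_eq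
      have h2 : (π.1.parts - S).sum + S.sum = π.1.parts.sum := by
        rw [← Multiset.sum_add, Multiset.sub_add_cancel π.2]
      omega⟩
  invFun π := ⟨⟨π.parts + S, π.overlined, fun i h => by
      rcases Multiset.mem_add.mp h with h | h
      · exact π.parts_pos i h
      · exact hS i h, π.overlined_pos, by
      have h := π.sum_eq
      rw [Multiset.sum_add]; omega⟩, Multiset.le_add_left _ _⟩
  left_inv := by
    rintro ⟨⟨p, o, h1, h2, h3⟩, h⟩
    simp [Multiset.sub_add_cancel h]
  right_inv := by
    rintro ⟨p, o, h1, h2, h3⟩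
    simp

theorem card_stair (r k n : ℕ) :
    Nat.card {π : Overpartition n // stair r k ≤ π.parts}
      = if r * (k * (k + 1) / 2) ≤ n then pbar (n - r * (k * (k + 1) / 2)) else 0 := by
  rw [← stair_sum]
  split_ifs with h
  · obtain ⟨m, rfl⟩ := Nat.exists_eq_add_of_le' h
    rw [Nat.add_sub_cancel, pbar]
    refine Nat.card_congr (shiftEquiv _ ?_ m)
    intro i hi
    have := Multiset.mem_of_mem_nsmul hi
    simp at this
    omega
  · have : IsEmpty {π : Overpartition n // stair r k ≤ π.parts} := by
      refine ⟨fun ⟨π, hπ⟩ => h ?_⟩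
      obtain ⟨t, ht⟩ := Multiset.le_iff_exists_add.mp hπ
      have h2 := π.sum_eq
      rw [ht, Multiset.sum_add] at h2
      omega
    simp

theorem sigmaRMex_eq (r : ℕ) (hr : 1 ≤ r) (n M : ℕ) (hM : n < M) :
    sigmaRMex r n = ∑ k ∈ Finset.range M,
      if r * (k * (k + 1) / 2) ≤ n then pbar (n - r * (k * (k + 1) / 2)) else 0 := by
  classical
  rw [sigmaRMex, finsum_eq_sum_of_fintype]
  have h1 : ∀ π : Overpartition n, π.rgap r
      = ∑ k ∈ Finset.range M, if stair r k ≤ π.parts then 1 else 0 := by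
    intro π
    have := rgap_le r hr π
    simp_rw [← lt_rgap_iff r hr]
    rw [← Finset.card_filter]
    have : Finset.filter (fun k => k < π.rgap r) (Finset.range M) = Finset.range (π.rgap r) := by
      ext k; simp; omega
    rw [this, Finset.card_range]
  rw [Finset.sum_congr rfl fun π _ => h1 π, Finset.sum_comm]
  refine Finset.sum_congr rfl fun k _ => ?_
  rw [← card_stair, Nat.card_eq_fintype_card, Fintype.card_subtype, Finset.card_filter]

variable (K : Type*) [Field K]

noncomputable def Pb : PowerSeries K := PowerSeries.mk fun n => (pbar n : K)

theorem lhs_dvd (r : ℕ) (hr : 1 ≤ r) (n M : ℕ) (hM : n ≤ M) :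
    (X : PowerSeries K) ^ n ∣ PowerSeries.mk (fun n => (sigmaRMex r n : K))
      - (∑ k ∈ Finset.range M, (X ^ r) ^ (k * (k + 1) / 2)) * Pb K := by
  rw [X_pow_dvd_iff]
  intro m hm
  rw [map_sub, coeff_mk, sigmaRMex_eq r hr m M (by omega), Finset.sum_mul, map_sum, sub_eq_zero]
  push_cast
  refine Finset.sum_congr rfl fun k _ => ?_
  rw [← pow_mul, coeff_X_pow_mul']
  simp [Pb]

section top
open scoped PowerSeries.WithPiTopology
open Filter
variable [TopologicalSpace K] [IsTopologicalRing K] [T2Space K]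

theorem mult_aux (f : ℕ → PowerSeries K) (hf : ∀ n, (X : PowerSeries K) ^ (n + 1) ∣ f n - 1) :
    Multipliable f := by
  have : f = fun n => 1 + (f n - 1) := by ext1 n; ring
  rw [this]
  apply WithPiTopology.multipliable_one_add_of_tendsto_order_atTop_nhds_top
  refine ENat.tendsto_nhds_top_iff_natCast_lt.mpr (fun n ↦ Filter.eventually_atTop.mpr ⟨n, ?_⟩)
  intro m hm
  have h := X_pow_dvd_iff.mp (hf m)
  refine lt_of_lt_of_le ?_ (PowerSeries.nat_le_order _ (m + 1) h)
  norm_cast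
  omega

theorem tprod_dvd (f : ℕ → PowerSeries K) (hf : ∀ n, (X : PowerSeries K) ^ (n + 1) ∣ f n - 1)
    (n : ℕ) : (X : PowerSeries K) ^ n ∣ (∏' i, f i) - ∏ i ∈ Finset.range n, f i := by
  have hstep : ∀ m, n ≤ m → (X : PowerSeries K) ^ n ∣
      (∏ i ∈ Finset.range m, f i) - ∏ i ∈ Finset.range n, f i := by
    intro m hm
    induction m, hm using Nat.le_induction with
    | base => simp
    | succ m hm ih =>
      rw [Finset.prod_range_succ]
      have h2 : (X : PowerSeries K) ^ n ∣ f m - 1 := (pow_dvd_pow _ (by omega)).trans (hf m)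
      have := dvd_add ih (h2.mul_left (∏ i ∈ Finset.range m, f i))
      convert this using 1
      ring
  have ht := (mult_aux K f hf).hasProd.tendsto_prod_nat
  rw [WithPiTopology.tendsto_iff_coeff_tendsto] at ht
  rw [X_pow_dvd_iff]
  intro d hd
  rw [map_sub, sub_eq_zero]
  refine tendsto_nhds_unique (ht d) (tendsto_atTop_of_eventually_const (i₀ := n) fun m hm => ?_)
  have := X_pow_dvd_iff.mp (hstep m hm) d hd
  rwa [map_sub, sub_eq_zero] at this

theorem distinct_gf : PowerSeries.mk (fun n => ((Nat.Partition.distincts n).card : K))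
    = ∏' n : ℕ, (1 + (X : PowerSeries K) ^ (n + 1)) := by
  have := Nat.Partition.powerSeriesMk_card_countRestricted_eq_tprod K (m := 2) (by norm_num)
  simp_rw [Nat.Partition.countRestricted_two] at this
  rw [this]
  simp [Finset.sum_range_succ]

theorem part_gf : PowerSeries.mk (fun n => (Fintype.card n.Partition : K)) *
    ∏' n : ℕ, (1 - (X : PowerSeries K) ^ (n + 1)) = 1 := by
  have := Nat.Partition.hasProd_powerSeriesMk_card_restricted K (fun _ => True)
  have h2 : ∀ n, (Nat.Partition.restricted n (fun _ => True)).card = Fintype.card n.Partition := by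
    intro n; simp [Nat.Partition.restricted]
  simp only [h2, if_true] at this
  rw [← this.tprod_eq, ← this.multipliable.tprod_mul (WithPiTopology.multipliable_one_sub_X_pow _)]
  simp_rw [pow_mul]
  have h3 : ∀ i : ℕ, (∑' j : ℕ, ((X : PowerSeries K) ^ (i + 1)) ^ j) * (1 - X ^ (i + 1)) = 1 :=
    fun i => WithPiTopology.tsum_pow_mul_one_sub_of_constantCoeff_eq_zero (by simp)
  simp [h3]

theorem Pb_eq : Pb K = PowerSeries.mk (fun n => (Fintype.card n.Partition : K)) *
    PowerSeries.mk (fun n => ((Nat.Partition.distincts n).card : K)) := by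
  ext n
  rw [coeff_mul, Pb, coeff_mk, pbar_eq]
  simp

theorem cc_of_dvd {f : PowerSeries K} (n : ℕ) (hn : 0 < n) (h : (X : PowerSeries K) ^ n ∣ f - 1) :
    constantCoeff f = 1 := by
  have := X_pow_dvd_iff.mp h 0 hn
  simpa [sub_eq_zero] using this

theorem main_aux (r : ℕ) (hr : 1 ≤ r) :
    PowerSeries.mk (fun n => (sigmaRMex r n : K))
      = (∏' n : ℕ, (1 + (X : PowerSeries K) ^ (n + 1))) *
          (∏' n : ℕ, (1 - (X : PowerSeries K) ^ (2 * r * (n + 1)))) *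
          ((∏' n : ℕ, (1 - (X : PowerSeries K) ^ (n + 1))) *
            ∏' n : ℕ, (1 - (X : PowerSeries K) ^ (r + 2 * r * n)))⁻¹ := by
  have hB : ∀ n, (X : PowerSeries K) ^ (n + 1) ∣ (1 - (X : PowerSeries K) ^ (2 * r * (n + 1))) - 1 := by
    intro n
    rw [sub_sub_cancel_left, dvd_neg]
    exact pow_dvd_pow _ (by nlinarith)
  have hD : ∀ n, (X : PowerSeries K) ^ (n + 1) ∣ (1 - (X : PowerSeries K) ^ (r + 2 * r * n)) - 1 := by
    intro n
    rw [sub_sub_cancel_left, dvd_neg]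
    exact pow_dvd_pow _ (by nlinarith)
  have hC : ∀ n, (X : PowerSeries K) ^ (n + 1) ∣ (1 - (X : PowerSeries K) ^ (n + 1)) - 1 := by
    intro n
    rw [sub_sub_cancel_left, dvd_neg]
  have hBd := tprod_dvd K _ hB
  have hDd := tprod_dvd K _ hD
  have hccD : constantCoeff (∏' n : ℕ, (1 - (X : PowerSeries K) ^ (r + 2 * r * n))) = 1 := by
    have := X_pow_dvd_iff.mp (hDd 1) 0 (by norm_num)
    have hr0 : r ≠ 0 := by omega
    simpa [sub_eq_zero, hr0] using this
  have hccC : constantCoeff (∏' n : ℕ, (1 - (X : PowerSeries K) ^ (n + 1))) = 1 := by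
    have := X_pow_dvd_iff.mp (tprod_dvd K _ hC 1) 0 (by norm_num)
    simpa [sub_eq_zero] using this
  rw [PowerSeries.eq_mul_inv_iff_mul_eq (by simp [hccC, hccD]), ← distinct_gf]
  have hpart := part_gf K
  set C := ∏' n : ℕ, (1 - (X : PowerSeries K) ^ (n + 1))
  set D := ∏' n : ℕ, (1 - (X : PowerSeries K) ^ (r + 2 * r * n))
  set B := ∏' n : ℕ, (1 - (X : PowerSeries K) ^ (2 * r * (n + 1)))
  set L := PowerSeries.mk (fun n => (sigmaRMex r n : K)) with hL
  have key : L * D = Pb K * B := by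
    rw [← sub_eq_zero]
    ext n
    rw [map_zero]
    suffices h : (X : PowerSeries K) ^ (n + 1) ∣ L * D - Pb K * B from
      X_pow_dvd_iff.mp h n (by omega)
    set q : PowerSeries K := X ^ r with hq
    have hcc : ∀ j, j ≠ 0 → constantCoeff (1 - q ^ j) ≠ 0 := by
      intro j hj
      have hr0 : r ≠ 0 := by omega
      simp [hq, hj, hr0]
    let u : ℕ → PowerSeries K := fun i => (1 - q ^ (2 * i + 1))⁻¹
    let v : ℕ → PowerSeries K := fun i => (1 - q ^ (2 * i + 2))⁻¹
    have hu : ∀ i, u i * (1 - q ^ (2 * i + 1)) = 1 := fun i =>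
      PowerSeries.inv_mul_cancel _ (hcc _ (by omega))
    have hv : ∀ i, v i * (1 - q ^ (2 * i + 2)) = 1 := fun i =>
      PowerSeries.inv_mul_cancel _ (hcc _ (by omega))
    let P : ℕ → PowerSeries K := fun m => ∏ i ∈ Finset.range m, ((1 - q ^ (2 * i + 2)) * u i)
    let g : ℕ → PowerSeries K := fun m => ∏ i ∈ Finset.range m, ((1 - q ^ (2 * i + 1)) * v i)
    have hS := shanks q u g P hu
      (fun m => by simp only [P, Finset.prod_range_succ]; ring)
      (fun s => by
        simp only [g, Finset.prod_range_succ]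
        linear_combination (∏ i ∈ Finset.range s, ((1 - q ^ (2 * i + 1)) * v i)) *
          (1 - q ^ (2 * s + 1)) * hv s)
      (fun m => by
        simp only [P, g, ← Finset.prod_mul_distrib]
        refine Finset.prod_eq_one fun i _ => ?_
        linear_combination (v i * (1 - q ^ (2 * i + 2))) * hu i + hv i)
      (n + 1)
    have hA : (X : PowerSeries K) ^ (n + 1) ∣
        (∑ s ∈ Finset.range (n + 1), g s * q ^ (s * (2 * (n + 1) + 1))) - 1 := by
      rw [Finset.sum_range_succ']
      have : g 0 * q ^ (0 * (2 * (n + 1) + 1)) = 1 := by simp [g]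
      rw [this, add_sub_cancel_right]
      refine Finset.dvd_sum fun s _ => Dvd.dvd.mul_left ?_ _
      rw [hq, ← pow_mul]
      have hb := Nat.mul_le_mul hr (le_refl ((s + 1) * (2 * (n + 1) + 1)))
      exact pow_dvd_pow _ (by nlinarith [Nat.zero_le (s * n)])
    have hLd := lhs_dvd K r hr (n + 1) (2 * (n + 1)) (by omega)
    rw [← hq, hS, ← hL] at hLd
    have hPD : P (n + 1) * ∏ i ∈ Finset.range (n + 1), (1 - (X : PowerSeries K) ^ (r + 2 * r * i))
        = ∏ i ∈ Finset.range (n + 1), (1 - (X : PowerSeries K) ^ (2 * r * (i + 1))) := by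
      simp only [P, ← Finset.prod_mul_distrib]
      refine Finset.prod_congr rfl fun i _ => ?_
      have e1 : (X : PowerSeries K) ^ (r + 2 * r * i) = q ^ (2 * i + 1) := by
        rw [hq, ← pow_mul]; congr 1; ring
      have e2 : (X : PowerSeries K) ^ (2 * r * (i + 1)) = q ^ (2 * i + 2) := by
        rw [hq, ← pow_mul]; congr 1; ring
      rw [e1, e2]
      linear_combination (1 - q ^ (2 * i + 2)) * hu i
    have hD1 := hDd (n + 1)
    have hB1 := hBd (n + 1)
    generalize (∑ s ∈ Finset.range (n + 1), g s * q ^ (s * (2 * (n + 1) + 1))) = A at *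
    generalize P (n + 1) = p at *
    rw [← hPD] at hB1
    generalize ∏ i ∈ Finset.range (n + 1), (1 - (X : PowerSeries K) ^ (r + 2 * r * i)) = d at *
    have := dvd_sub (dvd_add (dvd_add (hLd.mul_left D) (hD1.mul_left (p * A * Pb K)))
      (hA.mul_left (p * d * Pb K))) (hB1.mul_left (Pb K))
    convert this using 1
    ring
  rw [Pb_eq] at key
  linear_combination C * key +
    PowerSeries.mk (fun n => ((Nat.Partition.distincts n).card : K)) * B * hpart

end top

end OverGap

/-- Generating function: Σ σ_r mex̄(n) qⁿ = (−q;q)_∞ (q^{2r};q^{2r})_∞ /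
[(q;q)_∞ (q^r;q^{2r})_∞]. -/
theorem stmt7 (r : ℕ) (hr : 1 ≤ r) :
    PowerSeries.mk (fun n => (sigmaRMex r n : ℚ))
      = (∏' n : ℕ, (1 + (X : PowerSeries ℚ) ^ (n + 1))) *
          (∏' n : ℕ, (1 - (X : PowerSeries ℚ) ^ (2 * r * (n + 1)))) *
          ((∏' n : ℕ, (1 - (X : PowerSeries ℚ) ^ (n + 1))) *
            ∏' n : ℕ, (1 - (X : PowerSeries ℚ) ^ (r + 2 * r * n)))⁻¹ := by
  exact OverGap.main_aux ℚ r hr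
end

section
/- Asymptotically, σmex̄(n) ~ e^{π√n} / (8 n^{3/4}) as n → ∞. -/
namespace Overpartition

@[ext]
theorem ext' {n : ℕ} {a b : Overpartition n} (h1 : a.parts = b.parts)
    (h2 : a.overlined = b.overlined) : a = b := by
  cases a; cases b; simp_all

/-- An overpartition is a pair of a partition and a partition into distinct parts. -/
def equivSigma (n : ℕ) : Overpartition n ≃
    Σ ij : Finset.HasAntidiagonal.antidiagonal n, Nat.Partition ij.1.1 × Nat.Partition.distincts ij.1.2 where
  toFun π := ⟨⟨(π.parts.sum, π.overlined.val.sum), by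
      rw [Finset.HasAntidiagonal.mem_antidiagonal, Finset.sum_val]
      exact π.sum_eq⟩,
    ⟨π.parts, fun {i} hi => π.parts_pos i hi, rfl⟩,
    ⟨⟨π.overlined.val, fun {i} hi => π.overlined_pos i hi, rfl⟩, by
      simp [Nat.Partition.distincts, π.overlined.nodup]⟩⟩
  invFun x := ⟨x.2.1.parts, ⟨x.2.2.1.parts, by
      exact (Finset.mem_filter.1 x.2.2.2).2⟩, fun i hi => x.2.1.parts_pos hi,
      fun i hi => x.2.2.1.parts_pos hi, by
      have h1 := x.1.2
      have h2 := x.2.2.1.parts_sum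
      rw [Finset.HasAntidiagonal.mem_antidiagonal] at h1
      rw [x.2.1.parts_sum]
      exact (congrArg _ ((Finset.sum_val ⟨x.2.2.1.parts, _⟩).symm.trans h2)).trans h1⟩
  left_inv π := by ext <;> simp
  right_inv x := by
    obtain ⟨⟨⟨i, j⟩, h⟩, ⟨p, hp, hs⟩, ⟨⟨d, hd, hds⟩, hn⟩⟩ := x
    dsimp at hs hds
    subst hs hds
    rfl

noncomputable instance (n : ℕ) : Fintype (Overpartition n) :=
  Fintype.ofEquiv _ (equivSigma n).symm

theorem card_eq (n : ℕ) : Fintype.card (Overpartition n) =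
    ∑ ij ∈ Finset.HasAntidiagonal.antidiagonal n, Fintype.card (Nat.Partition ij.1) *
      (Nat.Partition.distincts ij.2).card := by
  rw [Fintype.card_congr (equivSigma n), Fintype.card_sigma]
  rw [← Finset.sum_coe_sort (Finset.HasAntidiagonal.antidiagonal n)
    (fun ij => Fintype.card (Nat.Partition ij.1) * (Nat.Partition.distincts ij.2).card)]
  refine Finset.sum_congr rfl fun ij _ => ?_
  rw [Fintype.card_prod, Fintype.card_coe]

theorem lt_mex_iff {n : ℕ} (π : Overpartition n) (m : ℕ) :
    m < π.mex ↔ ∀ i ∈ Finset.Icc 1 m, i ∈ π.parts := by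
  have hne : {m : ℕ | 0 < m ∧ m ∉ π.parts}.Nonempty := by
    by_contra h
    rw [Set.not_nonempty_iff_eq_empty] at h
    have : ∀ k, 0 < k → k ∈ π.parts := by
      intro k hk
      by_contra hc
      have : k ∈ {m : ℕ | 0 < m ∧ m ∉ π.parts} := ⟨hk, hc⟩
      rw [h] at this
      exact this
    have h1 := Multiset.le_sum_of_mem (this (n+1) (by omega))
    have := π.sum_eq
    omega
  unfold mex
  constructor
  · intro h i hi
    rw [Finset.mem_Icc] at hi
    by_contra hc
    have : sInf {m : ℕ | 0 < m ∧ m ∉ π.parts} ≤ i := Nat.sInf_le ⟨hi.1, hc⟩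
    omega
  · intro h
    by_contra hc
    have h1 := Nat.sInf_mem hne
    exact h1.2 (h _ (Finset.mem_Icc.2 ⟨h1.1, not_lt.1 hc⟩))

/-- Triangular numbers. -/
def tri (m : ℕ) : ℕ := ∑ i ∈ Finset.Icc 1 m, i

theorem tri_succ (m : ℕ) : tri (m+1) = tri m + (m+1) := by
  unfold tri
  rw [Finset.sum_Icc_succ_top (by omega)]

theorem le_tri (m : ℕ) : m ≤ tri m := by
  induction m with
  | zero => simp
  | succ k ih => rw [tri_succ]; omega

theorem icc_le_iff (s : Multiset ℕ) (m : ℕ) :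
    (Finset.Icc 1 m).val ≤ s ↔ ∀ i ∈ Finset.Icc 1 m, i ∈ s := by
  rw [Multiset.le_iff_subset (Finset.Icc 1 m).nodup]
  rfl

theorem icc_sum (m : ℕ) : (Finset.Icc 1 m).val.sum = tri m := by
  exact Finset.sum_val _

/-- Removing one copy of each of `1, …, m`. -/
def removeEquiv (k m : ℕ) :
    {π : Overpartition (k + tri m) // ∀ i ∈ Finset.Icc 1 m, i ∈ π.parts} ≃ Overpartition k where
  toFun π := ⟨π.1.parts - (Finset.Icc 1 m).val, π.1.overlined,
    fun i hi => π.1.parts_pos i (Multiset.mem_of_le (Multiset.sub_le_self _ _) hi),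
    π.1.overlined_pos, by
      have h := (icc_le_iff π.1.parts m).2 π.2
      have h1 := congrArg Multiset.sum (Multiset.sub_add_cancel h)
      rw [Multiset.sum_add, icc_sum] at h1
      have h2 := π.1.sum_eq
      omega⟩
  invFun π := ⟨⟨π.parts + (Finset.Icc 1 m).val, π.overlined, fun i hi => by
      rw [Multiset.mem_add] at hi
      rcases hi with hi | hi
      · exact π.parts_pos i hi
      · exact (Finset.mem_Icc.1 (Finset.mem_val ▸ hi)).1, π.overlined_pos, by
      rw [Multiset.sum_add, icc_sum]
      have h2 := π.sum_eq
      omega⟩, fun i hi => Multiset.mem_add.2 (Or.inr hi)⟩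
  left_inv π := by
    have h := (icc_le_iff π.1.parts m).2 π.2
    apply Subtype.ext
    ext1
    · exact Multiset.sub_add_cancel h
    · rfl
  right_inv π := by
    ext1
    · exact Multiset.add_sub_cancel_right
    · rfl

open Classical in
theorem card_filter_mex (n m : ℕ) :
    (Finset.univ.filter fun π : Overpartition n => m < π.mex).card =
      if tri m ≤ n then Fintype.card (Overpartition (n - tri m)) else 0 := by
  split_ifs with h
  · obtain ⟨k, rfl⟩ := Nat.exists_eq_add_of_le' h
    rw [Nat.add_sub_cancel, ← Fintype.card_congr (removeEquiv k m), Fintype.card_subtype]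
    congr 1
    ext π
    simp only [lt_mex_iff]
  · rw [Finset.card_eq_zero, Finset.filter_eq_empty_iff]
    intro π _ hm
    rw [lt_mex_iff, ← icc_le_iff] at hm
    obtain ⟨u, hu⟩ := Multiset.le_iff_exists_add.1 hm
    have h1 := congrArg Multiset.sum hu
    rw [Multiset.sum_add, icc_sum] at h1
    have := π.sum_eq
    omega

theorem sigmaMex_eq (n : ℕ) : sigmaMex n = ∑ m ∈ Finset.range (n+1),
    if tri m ≤ n then Fintype.card (Overpartition (n - tri m)) else 0 := by
  classical
  unfold sigmaMex
  rw [finsum_eq_sum_of_fintype]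
  simp_rw [← card_filter_mex, Finset.card_filter]
  rw [Finset.sum_comm]
  refine Finset.sum_congr rfl fun π _ => ?_
  rw [← Finset.card_filter]
  have : (Finset.range (n+1)).filter (fun m => m < π.mex) = Finset.range π.mex := by
    ext m
    simp only [Finset.mem_filter, Finset.mem_range, and_iff_right_iff_imp]
    intro hm
    have h2 := (lt_mex_iff π m).1 hm
    rw [← icc_le_iff] at h2
    obtain ⟨u, hu⟩ := Multiset.le_iff_exists_add.1 h2
    have h1 := congrArg Multiset.sum hu
    rw [Multiset.sum_add, icc_sum] at h1
    have := π.sum_eq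
    have := le_tri m
    omega
  rw [this, Finset.card_range]

theorem tri_strictMono : StrictMono tri := strictMono_nat_of_lt_succ fun m => by
  rw [tri_succ]; omega

theorem tri_mul_two (m : ℕ) : tri m * 2 = m * (m+1) := by
  induction m with
  | zero => simp [tri]
  | succ k ih => rw [tri_succ, add_mul, ih]; ring

open Classical in
/-- The generating function of triangular numbers. -/
noncomputable def psiSeries : PowerSeries ℝ :=
  PowerSeries.mk fun n => if n ∈ Set.range tri then 1 else 0

/-- The generating function of overpartitions. -/
noncomputable def overSeries : PowerSeries ℝ :=
  PowerSeries.mk fun n => (Fintype.card (Overpartition n) : ℝ)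

theorem sigmaMex_coeff (n : ℕ) :
    (sigmaMex n : ℝ) = PowerSeries.coeff n (psiSeries * overSeries) := by
  classical
  rw [PowerSeries.coeff_mul, sigmaMex_eq]
  simp only [psiSeries, overSeries, PowerSeries.coeff_mk]
  rw [Finset.Nat.sum_antidiagonal_eq_sum_range_succ
    (f := fun i j => (if i ∈ Set.range tri then (1:ℝ) else 0) * (Fintype.card (Overpartition j) : ℝ))]
  simp only [ite_mul, one_mul, zero_mul]
  push_cast
  rw [← Finset.sum_filter, ← Finset.sum_filter]
  refine Finset.sum_nbij tri ?_ ?_ ?_ ?_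
  · intro m hm
    simp at hm ⊢
    omega
  · exact tri_strictMono.injective.injOn
  · intro k hk
    simp at hk
    obtain ⟨hk, m, rfl⟩ := hk
    have := le_tri m
    exact ⟨m, by simp; omega, rfl⟩
  · intro m hm
    rfl

end Overpartition
namespace OverAsym

open PowerSeries Filter Topology

/-- The power series `A` converges absolutely at `q` with sum `s`. -/
def EvalAt (q : ℂ) (A : PowerSeries ℝ) (s : ℂ) : Prop :=
  Summable (fun n => ‖((coeff n A : ℝ) : ℂ) * q ^ n‖) ∧ HasSum (fun n => ((coeff n A : ℝ) : ℂ) * q ^ n) s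

theorem hasSum_congr' {f g : ℕ → ℂ} {a : ℂ} (h : HasSum f a) (hfg : ∀ n, g n = f n) :
    HasSum g a := by
  rw [funext hfg]
  exact h

theorem EvalAt.mul {q : ℂ} {A B : PowerSeries ℝ} {s t : ℂ} (hA : EvalAt q A s)
    (hB : EvalAt q B t) : EvalAt q (A * B) (s * t) := by
  have key : ∀ n, ((coeff n (A * B) : ℝ) : ℂ) * q ^ n =
      ∑ kl ∈ Finset.HasAntidiagonal.antidiagonal n, (((coeff kl.1 A : ℝ) : ℂ) * q ^ kl.1) *
        (((coeff kl.2 B : ℝ) : ℂ) * q ^ kl.2) := by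
    intro n
    rw [coeff_mul]
    push_cast
    rw [Finset.sum_mul]
    refine Finset.sum_congr rfl fun kl hkl => ?_
    rw [Finset.HasAntidiagonal.mem_antidiagonal] at hkl
    rw [← hkl, pow_add]
    ring
  have h1 : Summable (fun n => ‖((coeff n (A * B) : ℝ) : ℂ) * q ^ n‖) := by
    simp_rw [key]
    exact summable_norm_sum_mul_antidiagonal_of_summable_norm
      (f := fun n => ((coeff n A : ℝ) : ℂ) * q ^ n) (g := fun n => ((coeff n B : ℝ) : ℂ) * q ^ n)
      hA.1 hB.1
  refine ⟨h1, ?_⟩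
  have h2 := tsum_mul_tsum_eq_tsum_sum_antidiagonal_of_summable_norm
      (f := fun n => ((coeff n A : ℝ) : ℂ) * q ^ n) (g := fun n => ((coeff n B : ℝ) : ℂ) * q ^ n)
      hA.1 hB.1
  rw [hA.2.tsum_eq, hB.2.tsum_eq] at h2
  simp_rw [← key] at h2
  rw [h2]
  exact h1.of_norm.hasSum

theorem EvalAt.one (q : ℂ) : EvalAt q 1 1 := by
  have h : ∀ n ≠ 0, ((coeff n (1 : PowerSeries ℝ) : ℝ) : ℂ) * q ^ n = 0 := by
    intro n hn
    simp [coeff_one, hn]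
  constructor
  · refine summable_of_ne_finset_zero (s := {0}) fun n hn => ?_
    rw [h n (by simpa using hn), norm_zero]
  · have := hasSum_single (f := fun n => ((coeff n (1 : PowerSeries ℝ) : ℝ) : ℂ) * q ^ n) 0 h
    simpa using this

theorem EvalAt.prod {q : ℂ} {g : ℕ → PowerSeries ℝ} {v : ℕ → ℂ} (h : ∀ i, EvalAt q (g i) (v i))
    (N : ℕ) : EvalAt q (∏ i ∈ Finset.range N, g i) (∏ i ∈ Finset.range N, v i) := by
  induction N with
  | zero => simpa using EvalAt.one q
  | succ k ih =>
    rw [Finset.prod_range_succ, Finset.prod_range_succ]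
    exact ih.mul (h k)

open scoped PowerSeries.WithPiTopology in
theorem evalAt_of_hasProd {g : ℕ → PowerSeries ℝ} {G : PowerSeries ℝ} (hg : HasProd g G)
    (hnn : ∀ i n, 0 ≤ coeff n (g i)) (h1 : ∀ i, coeff 0 (g i) = 1) {q : ℂ} {v w : ℕ → ℂ}
    (hv : ∀ i, EvalAt q (g i) (v i)) (hw : ∀ i, EvalAt (‖q‖ : ℂ) (g i) (w i)) {C : ℝ}
    (hC : ∀ N, (∏ i ∈ Finset.range N, w i).re ≤ C) {V : ℂ}
    (hV : Tendsto (fun N => ∏ i ∈ Finset.range N, v i) atTop (𝓝 V)) : EvalAt q G V := by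
  set P : ℕ → PowerSeries ℝ := fun N => ∏ i ∈ Finset.range N, g i with hP
  have hPnn : ∀ N n, 0 ≤ coeff n (P N) := by
    intro N
    induction N with
    | zero => intro n; simp only [hP, Finset.range_zero, Finset.prod_empty, coeff_one]; split_ifs <;> simp
    | succ k ih =>
      intro n
      simp only [hP, Finset.prod_range_succ, coeff_mul]
      exact Finset.sum_nonneg fun x _ => mul_nonneg (ih _) (hnn _ _)
  have hmono : ∀ n, Monotone fun N => coeff n (P N) := by
    intro n
    refine monotone_nat_of_le_succ fun k => ?_
    have : P (k+1) = P k * g k := by simp only [hP, Finset.prod_range_succ]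
    rw [this, coeff_mul]
    have h := Finset.single_le_sum (s := Finset.HasAntidiagonal.antidiagonal n)
      (f := fun p : ℕ × ℕ => coeff p.1 (P k) * coeff p.2 (g k))
      (fun x _ => mul_nonneg (hPnn k _) (hnn _ _)) (a := (n, 0)) (by simp)
    simpa [h1] using h
  have htend : ∀ n, Tendsto (fun N => coeff n (P N)) atTop (𝓝 (coeff n G)) := by
    have := hg.tendsto_prod_nat
    rw [PowerSeries.WithPiTopology.tendsto_iff_coeff_tendsto] at this
    exact this
  have hle : ∀ n N, coeff n (P N) ≤ coeff n G := fun n N => (hmono n).ge_of_tendsto (htend n) N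
  have hGnn : ∀ n, 0 ≤ coeff n G := fun n => (hPnn 0 n).trans (hle n 0)
  have hnorm : ∀ n, ‖((coeff n G : ℝ) : ℂ) * q ^ n‖ = coeff n G * ‖q‖ ^ n := by
    intro n
    rw [norm_mul, norm_pow, Complex.norm_real, Real.norm_of_nonneg (hGnn n)]
  have hsum : Summable (fun n => ‖((coeff n G : ℝ) : ℂ) * q ^ n‖) := by
    simp_rw [hnorm]
    refine summable_of_sum_range_le (c := C) (fun n => by have := hGnn n; positivity) fun M => ?_
    have ht : Tendsto (fun N => ∑ n ∈ Finset.range M, coeff n (P N) * ‖q‖ ^ n) atTop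
        (𝓝 (∑ n ∈ Finset.range M, coeff n G * ‖q‖ ^ n)) :=
      tendsto_finsetSum _ fun n _ => (htend n).mul_const _
    refine le_of_tendsto' ht fun N => ?_
    refine le_trans ?_ (hC N)
    have he := Complex.hasSum_re (EvalAt.prod hw N).2
    have hre : ∀ n, (((coeff n (P N) : ℝ) : ℂ) * (‖q‖ : ℂ) ^ n).re = coeff n (P N) * ‖q‖ ^ n := by
      intro n
      rw [← Complex.ofReal_pow, ← Complex.ofReal_mul, Complex.ofReal_re]
    simp only [hP] at hre
    simp_rw [hre] at he
    exact sum_le_hasSum _ (fun n _ => mul_nonneg (hPnn N n) (by positivity)) he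
  refine ⟨hsum, ?_⟩
  have h2 : Tendsto (fun N => ∑' n, ((coeff n (P N) : ℝ) : ℂ) * q ^ n) atTop
      (𝓝 (∑' n, ((coeff n G : ℝ) : ℂ) * q ^ n)) := by
    refine tendsto_tsum_of_dominated_convergence hsum (fun n => ?_) (Eventually.of_forall fun N n => ?_)
    · exact ((Complex.continuous_ofReal.tendsto _).comp (htend n)).mul_const _
    · rw [hnorm, norm_mul, norm_pow, Complex.norm_real, Real.norm_of_nonneg (hPnn N n)]
      exact mul_le_mul_of_nonneg_right (hle n N) (by positivity)
  have h3 : ∀ N, ∑' n, ((coeff n (P N) : ℝ) : ℂ) * q ^ n = ∏ i ∈ Finset.range N, v i :=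
    fun N => (EvalAt.prod hv N).2.tsum_eq
  simp_rw [h3] at h2
  rw [tendsto_nhds_unique hV h2]
  exact hsum.of_norm.hasSum

/-- The Euler product `∏ (1 - q^k)`. -/
noncomputable def D (q : ℂ) : ℂ := ∏' n : ℕ, (1 - q ^ (n + 1))

theorem tendsto_D {q : ℂ} (hq : ‖q‖ < 1) :
    Tendsto (fun N => ∏ i ∈ Finset.range N, (1 - q ^ (i + 1))) atTop (𝓝 (D q)) :=
  (ModularForm.multipliable_one_sub_pow hq).hasProd.tendsto_prod_nat

theorem pow_ne_one' {q : ℂ} (hq : ‖q‖ < 1) (i : ℕ) : 1 - q ^ (i + 1) ≠ 0 := by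
  intro h
  have h1 : q ^ (i+1) = 1 := (sub_eq_zero.1 h).symm
  have h2 := congrArg norm h1
  rw [norm_pow, norm_one] at h2
  have := pow_lt_one₀ (norm_nonneg q) hq (Nat.succ_ne_zero i)
  simp at this
  linarith

theorem D_ne_zero {q : ℂ} (hq : ‖q‖ < 1) : D q ≠ 0 := by
  unfold D
  simp_rw [sub_eq_add_neg]
  refine tprod_one_add_ne_zero_of_summable (f := fun n : ℕ => -q ^ (n+1)) ?_ ?_
  · intro i
    simpa [sub_eq_add_neg] using pow_ne_one' hq i
  · simpa using (summable_nat_add_iff 1).mpr (summable_geometric_of_lt_one (norm_nonneg _) hq)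

theorem tendsto_over {q : ℂ} (hq : ‖q‖ < 1) :
    Tendsto (fun N => ∏ i ∈ Finset.range N, ((1 + q ^ (i + 1)) * (1 - q ^ (i + 1))⁻¹)) atTop
      (𝓝 (D (q ^ 2) / D q ^ 2)) := by
  have hq2 : ‖q ^ 2‖ < 1 := by
    rw [norm_pow]; exact pow_lt_one₀ (norm_nonneg q) hq (by norm_num)
  have h1 := (tendsto_D hq2).div ((tendsto_D hq).pow 2) (pow_ne_zero _ (D_ne_zero hq))
  refine h1.congr fun N => ?_
  simp only [Pi.div_apply]
  rw [← Finset.prod_pow, ← Finset.prod_div_distrib]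
  refine Finset.prod_congr rfl fun i _ => ?_
  have := pow_ne_one' hq i
  field_simp
  ring

theorem evalAt_geom {q : ℂ} (hq : ‖q‖ < 1) (i : ℕ) :
    EvalAt q (PowerSeries.mk fun n => if (i+1) ∣ n then 1 else 0) (1 - q ^ (i+1))⁻¹ := by
  have hq2 : ‖q ^ (i+1)‖ < 1 := by
    rw [norm_pow]; exact pow_lt_one₀ (norm_nonneg q) hq (by omega)
  have hinj : Function.Injective (fun j : ℕ => (i+1) * j) := fun a b h => by
    simpa using h
  have hz : ∀ x ∉ Set.range (fun j : ℕ => (i+1) * j),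
      (((PowerSeries.coeff x (PowerSeries.mk fun n => if (i+1) ∣ n then (1:ℝ) else 0)) : ℝ) : ℂ)
        * q ^ x = 0 := by
    intro x hx
    have : ¬ (i+1) ∣ x := by
      rintro ⟨k, rfl⟩
      exact hx ⟨k, rfl⟩
    simp [this]
  constructor
  · rw [← hinj.summable_iff (fun x hx => by rw [hz x hx, norm_zero])]
    refine (summable_geometric_of_lt_one (norm_nonneg _) hq2).congr fun j => ?_
    simp [pow_mul]
  · rw [← hinj.hasSum_iff hz]
    refine hasSum_congr' ((hasSum_geometric_of_norm_lt_one hq2)) fun j => ?_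
    simp [pow_mul]

theorem evalAt_one_add (q : ℂ) (i : ℕ) :
    EvalAt q (1 + X ^ (i+1)) (1 + q ^ (i+1)) := by
  have hz : ∀ x ∉ ({0, i+1} : Finset ℕ),
      ((coeff x (1 + X ^ (i+1) : PowerSeries ℝ) : ℝ) : ℂ) * q ^ x = 0 := by
    intro x hx
    simp at hx
    simp [coeff_one, coeff_X_pow, hx]
  constructor
  · exact summable_of_ne_finset_zero (s := {0, i+1}) fun n hn => by rw [hz n hn, norm_zero]
  · have := hasSum_sum_of_ne_finset_zero (L := .unconditional ℕ) hz
    rw [Finset.sum_pair (by omega)] at this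
    simpa [coeff_one, coeff_X_pow] using this

open scoped PowerSeries.WithPiTopology in
theorem geom_eq (i : ℕ) : (∑' j : ℕ, (X : PowerSeries ℝ) ^ ((i + 1) * j)) =
    PowerSeries.mk fun n => if (i+1) ∣ n then 1 else 0 := by
  refine HasSum.tsum_eq ?_
  rw [PowerSeries.WithPiTopology.hasSum_iff_hasSum_coeff]
  intro d
  simp only [coeff_X_pow, coeff_mk]
  by_cases h : (i+1) ∣ d
  · obtain ⟨k, rfl⟩ := h
    have := hasSum_single (f := fun j => if (i+1) * k = (i+1) * j then (1:ℝ) else 0) k (by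
      intro j hj
      rw [if_neg]
      simpa using fun h => hj h.symm)
    simpa using this
  · rw [if_neg h]
    convert hasSum_zero with j
    rw [if_neg]
    rintro rfl
    exact h ⟨j, rfl⟩

open scoped PowerSeries.WithPiTopology in
theorem overSeries_hasProd : HasProd (fun i : ℕ => (1 + X ^ (i+1)) *
    (PowerSeries.mk fun n => if (i+1) ∣ n then (1:ℝ) else 0)) Overpartition.overSeries := by
  have h1 := Nat.Partition.hasProd_powerSeriesMk_card_restricted ℝ (fun _ => True)
  have h2 := Nat.Partition.hasProd_powerSeriesMk_card_countRestricted ℝ (m := 2) (by norm_num)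
  have h3 := h2.mul h1
  have e1 : (fun i : ℕ => (1 + X ^ (i+1)) *
      (PowerSeries.mk fun n => if (i+1) ∣ n then (1:ℝ) else 0)) = fun i : ℕ =>
      (∑ j ∈ Finset.range 2, X ^ ((i + 1) * j)) * if True then ∑' j : ℕ, X ^ ((i + 1) * j) else 1 := by
    funext i
    rw [if_pos trivial, geom_eq]
    simp [Finset.sum_range_succ]
  rw [e1]
  have e2 : Overpartition.overSeries =
      (PowerSeries.mk fun n => ((Nat.Partition.countRestricted n 2).card : ℝ)) *
      PowerSeries.mk fun n => ((Nat.Partition.restricted n fun _ => True).card : ℝ) := by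
    ext n
    rw [mul_comm, coeff_mul]
    simp only [Overpartition.overSeries, coeff_mk, Overpartition.card_eq,
      Nat.Partition.countRestricted_two]
    push_cast
    refine Finset.sum_congr rfl fun ij _ => ?_
    simp [Nat.Partition.restricted]
  rw [e2]
  exact h3

theorem evalAt_over {q : ℂ} (hq : ‖q‖ < 1) :
    EvalAt q Overpartition.overSeries (D (q ^ 2) / D q ^ 2) := by
  have hr : ‖((‖q‖ : ℝ) : ℂ)‖ < 1 := by simpa using hq
  have hb := (Complex.continuous_re.tendsto _).comp (tendsto_over hr)
  obtain ⟨C, hC⟩ := hb.bddAbove_range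
  refine evalAt_of_hasProd overSeries_hasProd ?_ ?_
    (fun i => (evalAt_one_add q i).mul (evalAt_geom hq i))
    (fun i => (evalAt_one_add _ i).mul (evalAt_geom hr i)) (C := C)
    (fun N => hC ⟨N, rfl⟩) (tendsto_over hq)
  · intro i n
    rw [coeff_mul]
    refine Finset.sum_nonneg fun x _ => mul_nonneg ?_ ?_
    · rw [map_add, coeff_one, coeff_X_pow]
      split_ifs <;> norm_num
    · rw [coeff_mk]
      split_ifs <;> norm_num
  · intro i
    simp [coeff_zero_eq_constantCoeff]

/-- The theta series `∑ q^(m(m+1)/2)`. -/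
noncomputable def psi (q : ℂ) : ℂ := ∑' m : ℕ, q ^ Overpartition.tri m

theorem summable_psi {r : ℝ} (h0 : 0 ≤ r) (hr : r < 1) :
    Summable fun m : ℕ => r ^ Overpartition.tri m :=
  (summable_geometric_of_lt_one h0 hr).of_nonneg_of_le (fun m => by positivity)
    fun m => pow_le_pow_of_le_one h0 hr.le (Overpartition.le_tri m)

theorem summable_psi_norm {q : ℂ} (hq : ‖q‖ < 1) :
    Summable fun m : ℕ => ‖q ^ Overpartition.tri m‖ := by
  simp_rw [norm_pow]
  exact summable_psi (norm_nonneg q) hq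

theorem evalAt_psi {q : ℂ} (hq : ‖q‖ < 1) :
    EvalAt q Overpartition.psiSeries (psi q) := by
  have hinj := Overpartition.tri_strictMono.injective
  have hz : ∀ x ∉ Set.range Overpartition.tri,
      (((PowerSeries.coeff x Overpartition.psiSeries) : ℝ) : ℂ) * q ^ x = 0 := by
    intro x hx
    simp only [Overpartition.psiSeries, coeff_mk, if_neg hx]
    simp
  constructor
  · rw [← hinj.summable_iff (fun x hx => by rw [hz x hx, norm_zero])]
    refine (summable_psi_norm hq).congr fun j => ?_
    simp [Overpartition.psiSeries]
  · rw [← hinj.hasSum_iff hz]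
    refine hasSum_congr' ((summable_psi_norm hq).of_norm.hasSum) fun j => ?_
    simp [Overpartition.psiSeries]

/-- The generating function of `sigmaMex`. -/
noncomputable def H (q : ℂ) : ℂ := psi q * (D (q ^ 2) / D q ^ 2)

theorem H_summable {q : ℂ} (hq : ‖q‖ < 1) : Summable fun n : ℕ => ‖(sigmaMex n : ℂ) * q ^ n‖ := by
  refine ((evalAt_psi hq).mul (evalAt_over hq)).1.congr fun n => ?_
  rw [← Overpartition.sigmaMex_coeff, Complex.ofReal_natCast]

theorem H_hasSum {q : ℂ} (hq : ‖q‖ < 1) : HasSum (fun n : ℕ => (sigmaMex n : ℂ) * q ^ n) (H q) := by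
  refine hasSum_congr' (((evalAt_psi hq).mul (evalAt_over hq)).2) fun n => ?_
  rw [← Overpartition.sigmaMex_coeff, Complex.ofReal_natCast]

end OverAsym
namespace OverAsym

open Filter Topology Complex
open scoped Real

theorem tendsto_D_zero : Tendsto D (𝓝 0) (𝓝 1) := by
  have := tendsto_tprod_one_add_of_dominated_convergence (𝓕 := 𝓝 0) (g := 0)
    (f := fun (q : ℂ) (n : ℕ) ↦ -q ^ (n + 1)) (bound := fun n ↦ (1 / 2 : ℝ) ^ (n + 1))
  simp only [Pi.zero_apply, norm_neg, norm_pow, add_zero, tprod_one] at this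
  unfold D
  simp_rw [sub_eq_add_neg]
  refine this
    (by simpa only [pow_succ'] using (summable_geometric_of_abs_lt_one (by norm_num)).mul_left _)
    (fun k ↦ by simpa using ((continuous_pow (M := ℂ) (k + 1)).tendsto 0).neg) ?_
  filter_upwards [Metric.ball_mem_nhds (0 : ℂ) (by norm_num : (0 : ℝ) < 1 / 2)] with q hq k
  exact pow_le_pow_left₀ (norm_nonneg _) (mem_ball_zero_iff.mp hq).le _

theorem tendsto_theta {ι : Type*} {l : Filter ι} {τ : ι → ℂ}
    (h : Tendsto (fun i => (τ i).im) l atTop) :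
    Tendsto (fun i => jacobiTheta₂ (1/2) (τ i)) l (𝓝 1) := by
  have hs : Summable fun n : ℤ => ‖jacobiTheta₂_term n 0 I‖ :=
    ((summable_jacobiTheta₂_term_iff 0 I).2 (by simp)).norm
  have h1 := tendsto_tsum_of_dominated_convergence (𝓕 := l)
    (f := fun i (n : ℤ) => jacobiTheta₂_term n (1/2) (τ i))
    (g := fun n => if n = 0 then 1 else 0) hs ?_ ?_
  · simpa [jacobiTheta₂] using h1
  · intro n
    by_cases hn : n = 0
    · subst hn
      simp [jacobiTheta₂_term]
      exact tendsto_const_nhds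
    · simp only [hn, if_false]
      rw [tendsto_zero_iff_norm_tendsto_zero]
      simp_rw [norm_jacobiTheta₂_term]
      refine Real.tendsto_exp_atBot.comp ?_
      have hpos : 0 < π * (n:ℝ) ^ 2 := by positivity
      have h2 := tendsto_neg_atTop_atBot.comp (h.const_mul_atTop hpos)
      refine h2.congr fun i => ?_
      have : ((1/2 : ℂ)).im = 0 := by simp
      simp only [Function.comp, this]
      ring
  · filter_upwards [h.eventually_ge_atTop 1] with i hi n
    rw [norm_jacobiTheta₂_term, norm_jacobiTheta₂_term, Real.exp_le_exp]
    have : ((1/2 : ℂ)).im = 0 := by simp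
    rw [this]
    simp only [I_im, zero_im]
    have hpos : 0 ≤ π * (n:ℝ) ^ 2 := by positivity
    nlinarith

theorem log_I_mul {w : ℂ} (hw : 0 < w.re) : log (I * w) = log I + log w := by
  have hw0 : w ≠ 0 := by rintro rfl; simp at hw
  rw [Complex.log_mul I_ne_zero hw0]
  have := (abs_arg_lt_pi_div_two_iff.2 (Or.inl hw))
  rw [abs_lt] at this
  rw [arg_I]
  constructor <;> linarith [this.1, this.2]

theorem eta_eq (z : ℂ) : ModularForm.eta (I * z / (2 * π)) = exp (-z/24) * D (exp (-z)) := by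
  have hpi : (π : ℂ) ≠ 0 := by exact_mod_cast Real.pi_ne_zero
  unfold ModularForm.eta D
  simp_rw [ModularForm.eta_q_eq_pow]
  have h1 : 2 * π * I * (I * z / (2 * π)) = -z := by
    field_simp
    rw [I_sq]; ring
  rw [h1, Function.Periodic.qParam, h1]
  simp

theorem D_transform {z : ℂ} (hz : 0 < z.re) : D (exp (-z)) =
    exp (z/24) * exp (-(log (z / (2 * π)) / 2)) * exp (-π^2/(6*z)) * D (exp (-(4*π^2/z))) := by
  have hpi : (π : ℂ) ≠ 0 := by exact_mod_cast Real.pi_ne_zero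
  have hz0 : z ≠ 0 := by rintro rfl; simp at hz
  have hwre : 0 < (z / (2 * π)).re := by
    have : z / (2 * π) = z / ((2 * π : ℝ) : ℂ) := by push_cast; rfl
    rw [this, Complex.div_ofReal_re]
    positivity
  have hw0 : z / (2 * π) ≠ 0 := by intro h; rw [h] at hwre; simp at hwre
  have hmem : I * z / (2 * π) ∈ UpperHalfPlane.upperHalfPlaneSet := by
    show 0 < (I * z / (2 * π)).im
    rw [mul_div_assoc, I_mul_im]
    exact hwre
  have h := ModularForm.eta_comp_eq_csqrt_I_inv hmem
  simp only [Function.comp, Pi.smul_apply, Pi.mul_apply, smul_eq_mul] at h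
  have h1 : -1 / (I * z / (2 * π)) = I * (4 * π^2 / z) / (2 * π) := by
    field_simp
    rw [I_sq]; ring
  rw [h1, eta_eq, eta_eq, sqrt_eq_exp I_ne_zero, mul_div_assoc I z (2 * (π:ℂ)),
    sqrt_eq_exp (mul_ne_zero I_ne_zero hw0), log_I_mul hwre, add_div, exp_add] at h
  have h2 : exp (-(4*π^2/z)/24) = exp (-π^2/(6*z)) := by
    congr 1
    field_simp
    ring
  rw [h2] at h
  have h3 : exp (z/24) * exp (-z/24) = 1 := by
    rw [← exp_add]; ring_nf; simp
  have h4 : exp (-(log (z / (2 * π)) / 2)) * exp (log (z / (2 * π)) / 2) = 1 := by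
    rw [← exp_add]; ring_nf; simp
  have h5 : exp (log I / 2) ≠ 0 := exp_ne_zero _
  have h6 : exp (-π^2/(6*z)) * D (exp (-(4*π^2/z))) =
      exp (log (z / (2 * π)) / 2) * exp (-z/24) * D (exp (-z)) := by
    rw [h]; field_simp
  rw [mul_assoc, h6]
  linear_combination (-D (exp (-z))) * h3 * (exp (-(log (z / (2 * π)) / 2)) * exp (log (z / (2 * π)) / 2)) - D (exp (-z)) * h4

theorem psi_transform {z : ℂ} (hz : 0 < z.re) : psi (exp (-z)) =
    1/2 * exp (-(log (z / (2 * π)) / 2)) * exp (z/8) * jacobiTheta₂ (1/2) (2 * π * I / z) := by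
  have hpi : (π : ℂ) ≠ 0 := by exact_mod_cast Real.pi_ne_zero
  have hz0 : z ≠ 0 := by rintro rfl; simp at hz
  have hwre : 0 < (z / (2 * π)).re := by
    have : z / (2 * π) = z / ((2 * π : ℝ) : ℂ) := by push_cast; rfl
    rw [this, Complex.div_ofReal_re]
    positivity
  have hw0 : z / (2 * π) ≠ 0 := by intro h; rw [h] at hwre; simp at hwre
  have hq : ‖exp (-z)‖ < 1 := by
    rw [norm_exp]; simpa using hz
  have hs := (summable_psi_norm hq).of_norm.hasSum
  set τ : ℂ := I * z / (2 * π) with hτ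
  have hterm : ∀ n : ℕ, jacobiTheta₂_term n (τ/2) τ = exp (-z) ^ Overpartition.tri n := by
    intro n
    rw [jacobiTheta₂_term, ← exp_nat_mul]
    congr 1
    have h2 : (Overpartition.tri n : ℂ) = n * (n+1) / 2 := by
      rw [eq_div_iff two_ne_zero]; exact_mod_cast Overpartition.tri_mul_two n
    rw [h2, hτ]
    push_cast
    field_simp
    rw [I_sq]; ring
  have hterm2 : ∀ n : ℕ, jacobiTheta₂_term (-(n + 1 : ℤ)) (τ/2) τ = exp (-z) ^ Overpartition.tri n := by
    intro n
    rw [jacobiTheta₂_term, ← exp_nat_mul]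
    congr 1
    have h2 : (Overpartition.tri n : ℂ) = n * (n+1) / 2 := by
      rw [eq_div_iff two_ne_zero]; exact_mod_cast Overpartition.tri_mul_two n
    rw [h2, hτ]
    push_cast
    field_simp
    rw [I_sq]; ring
  have h1 : HasSum (fun n : ℤ => jacobiTheta₂_term n (τ/2) τ) (psi (exp (-z)) + psi (exp (-z))) := by
    refine HasSum.of_nat_of_neg_add_one ?_ ?_
    · simp_rw [hterm]; exact hs
    · simp_rw [hterm2]; exact hs
  have h2 := h1.tsum_eq
  change jacobiTheta₂ (τ/2) τ = _ at h2
  rw [jacobiTheta₂_functional_equation] at h2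
  have e1 : -I * τ = z / (2 * π) := by
    rw [hτ]; field_simp; rw [I_sq]; ring
  have hτ0 : τ ≠ 0 := by
    rw [hτ, mul_div_assoc]; exact mul_ne_zero I_ne_zero hw0
  have e2 : -π * I * (τ/2)^2 / τ = z/8 := by
    rw [hτ]; field_simp; rw [I_sq]; ring
  have e3 : τ / 2 / τ = 1/2 := by field_simp
  have e4 : -1 / τ = 2 * π * I / z := by
    rw [hτ]; field_simp; rw [I_sq]
  rw [e1, e2, e3, e4, cpow_def_of_ne_zero hw0, one_div, ← exp_neg] at h2
  have e5 : -(log (z / (2 * π)) * (1/2)) = -(log (z / (2 * π)) / 2) := by ring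
  rw [e5] at h2
  linear_combination (-1/2) * h2

theorem H_transform {z : ℂ} (hz : 0 < z.re) : H (exp (-z)) =
    exp (π^2/(4*z)) * (1/2 * exp (-(Real.log 2 / 2)) * exp (z/8) * jacobiTheta₂ (1/2) (2 * π * I / z) *
      (D (exp (-(2*π^2/z))) / D (exp (-(4*π^2/z))) ^ 2)) := by
  have hpi : (π : ℂ) ≠ 0 := by exact_mod_cast Real.pi_ne_zero
  have hz0 : z ≠ 0 := by rintro rfl; simp at hz
  have hw0 : z / (2 * π) ≠ 0 := by
    refine div_ne_zero hz0 (by simp [Real.pi_ne_zero])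
  have h2z : exp (-z) ^ 2 = exp (-(2 * z)) := by
    rw [← exp_nat_mul]; congr 1; push_cast; ring
  unfold H
  rw [psi_transform hz, h2z, D_transform hz, D_transform (z := 2 * z) (by simpa using hz)]
  have e1 : log (2 * z / (2 * π)) = Real.log 2 + log (z / (2 * π)) := by
    rw [mul_div_assoc]
    exact_mod_cast log_ofReal_mul (r := 2) (by norm_num) hw0
  have e2 : 4 * (π:ℂ)^2 / (2 * z) = 2 * π^2 / z := by field_simp; ring
  rw [e1, e2]
  set L := log (z / (2 * π))
  set A := D (exp (-(2*π^2/z)))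
  set B := D (exp (-(4*π^2/z)))
  set T := jacobiTheta₂ (1/2) (2 * π * I / z)
  have e3 : 1/2 * exp (-(L/2)) * exp (z/8) * T *
      (exp (2*z/24) * exp (-((Real.log 2 + L)/2)) * exp (-π^2/(6*(2*z))) * A /
        (exp (z/24) * exp (-(L/2)) * exp (-π^2/(6*z)) * B)^2) =
      (exp (-(L/2)) * exp (z/8) * (exp (2*z/24) * exp (-((Real.log 2 + L)/2)) * exp (-π^2/(6*(2*z))))
        / (exp (z/24) * exp (-(L/2)) * exp (-π^2/(6*z)))^2) * (1/2 * T * (A/B^2)) := by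
    rw [mul_pow _ B]
    ring
  rw [e3]
  have e4 : (exp (-(L/2)) * exp (z/8) * (exp (2*z/24) * exp (-((Real.log 2 + L)/2)) * exp (-π^2/(6*(2*z))))
        / (exp (z/24) * exp (-(L/2)) * exp (-π^2/(6*z)))^2) =
      exp (π^2/(4*z)) * exp (-(Real.log 2 / 2)) * exp (z/8) := by
    simp only [← exp_add]
    rw [← exp_nat_mul, ← exp_sub]
    congr 1
    push_cast
    field_simp
    ring
  rw [e4]
  ring

/-- The constant `2^(-3/2)`. -/
noncomputable def c0 : ℝ := 1/2 * Real.exp (-(Real.log 2 / 2))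

/-- The normalised generating function near `q = 1`. -/
noncomputable def J (z : ℂ) : ℂ := 1/2 * exp (-(Real.log 2 / 2)) * exp (z/8) *
  jacobiTheta₂ (1/2) (2 * π * I / z) * (D (exp (-(2*π^2/z))) / D (exp (-(4*π^2/z))) ^ 2)

theorem tendsto_J {ι : Type*} {l : Filter ι} {z : ι → ℂ} (h0 : Tendsto z l (𝓝 0))
    (h1 : Tendsto (fun i => ((z i)⁻¹).re) l atTop) : Tendsto (fun i => J (z i)) l (𝓝 (c0 : ℂ)) := by
  have hD : ∀ c : ℝ, 0 < c → Tendsto (fun i => D (exp (-(c * (z i)⁻¹)))) l (𝓝 1) := by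
    intro c hc
    refine tendsto_D_zero.comp ?_
    rw [tendsto_zero_iff_norm_tendsto_zero]
    simp_rw [norm_exp, neg_re, re_ofReal_mul]
    exact Real.tendsto_exp_atBot.comp (tendsto_neg_atTop_atBot.comp (h1.const_mul_atTop hc))
  have hT : Tendsto (fun i => jacobiTheta₂ (1/2) (2 * π * I / (z i))) l (𝓝 1) := by
    refine tendsto_theta ?_
    have : ∀ i, (2 * π * I / (z i)).im = 2 * π * ((z i)⁻¹).re := by
      intro i
      have : 2 * π * I / (z i) = ((2 * π : ℝ) : ℂ) * (I * (z i)⁻¹) := by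
        push_cast; rw [div_eq_mul_inv]; ring
      rw [this, im_ofReal_mul, I_mul_im]
    simp_rw [this]
    exact h1.const_mul_atTop (by positivity)
  have hE : Tendsto (fun i => exp (z i / 8)) l (𝓝 1) := by
    have := (continuous_exp.tendsto _).comp (h0.div_const 8)
    simpa [Function.comp_def] using this
  have h2 := hD (2 * π^2) (by positivity)
  have h4 := hD (4 * π^2) (by positivity)
  have := ((hE.const_mul (1/2 * exp (-(Real.log 2 / 2)))).mul hT).mul (h2.div (h4.pow 2) (by simp))
  have e : ((1/2 * exp (-(Real.log 2 / 2))) * 1 * 1 * (1 / 1^2) : ℂ) = (c0 : ℂ) := by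
    rw [c0]; push_cast; ring
  rw [e] at this
  refine this.congr fun i => ?_
  simp only [J, Pi.div_apply]
  push_cast
  simp only [div_eq_mul_inv]

theorem H_eq_J {z : ℂ} (hz : 0 < z.re) : H (exp (-z)) = exp (π^2/(4*z)) * J z := H_transform hz

end OverAsym
namespace OverAsym

open Filter Topology Complex
open scoped Real

theorem factor_bound {w : ℂ} (hw : ‖w‖ < 1) : ‖(1 + w) * (1 - w)⁻¹‖ ≤
    (1 + ‖w‖) * (1 - ‖w‖)⁻¹ * Real.exp (-(‖w‖ - w.re) / 4) := by
  set ρ := ‖w‖ with hρ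
  have h0 : 0 ≤ ρ := norm_nonneg w
  have hre : w.re ≤ ρ := Complex.re_le_norm w
  have h1 : ‖(1 - w)⁻¹‖ ≤ (1 - ρ)⁻¹ := by
    rw [norm_inv]
    apply inv_anti₀ (by linarith)
    have := norm_sub_norm_le (1:ℂ) w
    simpa using this
  have hsq : ‖1 + w‖ ^ 2 = (1 + ρ) ^ 2 - 2 * (ρ - w.re) := by
    have e1 : ρ ^ 2 = w.re ^ 2 + w.im ^ 2 := by
      rw [hρ, Complex.sq_norm, normSq_apply]; ring
    rw [Complex.sq_norm, normSq_apply]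
    simp
    linear_combination -e1
  have h2 : ‖1 + w‖ ≤ (1 + ρ) * Real.exp (-(ρ - w.re) / 4) := by
    refine abs_le_of_sq_le_sq' ?_ (by positivity) |>.2
    rw [hsq, mul_pow, ← Real.exp_nat_mul]
    have h3 := Real.add_one_le_exp (((2:ℕ):ℝ) * (-(ρ - w.re) / 4))
    have h4 : (1 + ρ)^2 * (((2:ℕ):ℝ) * (-(ρ - w.re) / 4) + 1) ≤
        (1 + ρ)^2 * Real.exp (((2:ℕ):ℝ) * (-(ρ - w.re) / 4)) := by gcongr
    refine le_trans ?_ h4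
    push_cast
    have h5 : (1 + ρ)^2 ≤ 4 := by nlinarith
    nlinarith
  rw [norm_mul]
  calc _ ≤ ((1 + ρ) * Real.exp (-(ρ - w.re) / 4)) * (1 - ρ)⁻¹ := by gcongr
    _ = _ := by ring

theorem norm_psi_le {q : ℂ} (hq : ‖q‖ < 1) : ‖psi q‖ ≤ ‖psi (‖q‖ : ℝ)‖ := by
  have hs := summable_psi (norm_nonneg q) hq
  have h1 : psi (‖q‖ : ℝ) = ((∑' m : ℕ, ‖q‖ ^ Overpartition.tri m : ℝ) : ℂ) := by
    unfold psi
    push_cast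
    rfl
  rw [h1, Complex.norm_real, Real.norm_of_nonneg (tsum_nonneg fun m => by positivity)]
  refine tsum_of_norm_bounded hs.hasSum fun m => ?_
  rw [norm_pow]

theorem tendsto_g {q : ℂ} (hq : ‖q‖ < 1) :
    Tendsto (fun N => ∑ i ∈ Finset.range N, (‖q ^ (i+1)‖ - (q ^ (i+1)).re)) atTop
      (𝓝 ((1 - ‖q‖)⁻¹ - ((1 - q)⁻¹).re)) := by
  have h1 := hasSum_geometric_of_lt_one (norm_nonneg q) hq
  have h2 := Complex.hasSum_re (hasSum_geometric_of_norm_lt_one hq)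
  have h3 := (tendsto_add_atTop_iff_nat 1).2 (h1.sub h2).tendsto_sum_nat
  refine h3.congr fun N => ?_
  rw [Finset.sum_range_succ']
  simp

theorem H_bound {q : ℂ} (hq : ‖q‖ < 1) : ‖H q‖ ≤
    ‖H (‖q‖ : ℝ)‖ * Real.exp (-((1 - ‖q‖)⁻¹ - ((1 - q)⁻¹).re) / 4) := by
  have hr : ‖((‖q‖ : ℝ) : ℂ)‖ < 1 := by simpa using hq
  have h1 := (tendsto_over hq).norm
  have h2 := (tendsto_over hr).norm
  have h3 := ((Real.continuous_exp.tendsto _).comp (((tendsto_g hq).neg).div_const 4))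
  have h4 := le_of_tendsto_of_tendsto' h1 (h2.mul h3) (fun N => by
    simp only [Function.comp]
    rw [norm_prod, norm_prod, ← Finset.sum_neg_distrib, Finset.sum_div, Real.exp_sum,
      ← Finset.prod_mul_distrib]
    refine Finset.prod_le_prod (fun i _ => norm_nonneg _) fun i _ => ?_
    have hw : ‖q ^ (i+1)‖ < 1 := by
      rw [norm_pow]; exact pow_lt_one₀ (norm_nonneg _) hq (by simp)
    refine (factor_bound hw).trans (le_of_eq ?_)
    congr 1
    have e : (1 + ((‖q‖:ℝ):ℂ) ^ (i+1)) * (1 - ((‖q‖:ℝ):ℂ) ^ (i+1))⁻¹ =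
        (((1 + ‖q ^ (i+1)‖) * (1 - ‖q ^ (i+1)‖)⁻¹ : ℝ) : ℂ) := by
      rw [norm_pow]; push_cast; rfl
    rw [e, Complex.norm_real, Real.norm_of_nonneg]
    have : 0 < 1 - ‖q ^ (i+1)‖ := by linarith
    positivity)
  unfold H
  rw [norm_mul, norm_mul, mul_assoc]
  exact mul_le_mul (norm_psi_le hq) h4 (norm_nonneg _) (norm_nonneg _)

theorem g_eq {r θ : ℝ} (h0 : 0 < r) (h1 : r < 1) :
    (1 - r)⁻¹ - ((1 - r * exp (θ * I))⁻¹).re =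
      (r * (2 * (1 - Real.cos θ))) * (1 + r) /
        (2 * (1 - r) * ((1 - r)^2 + r * (2 * (1 - Real.cos θ)))) := by
  have ha : 0 < 1 - r := by linarith
  have hc := Real.cos_le_one θ
  have hs : 0 ≤ r * (2 * (1 - Real.cos θ)) := mul_nonneg h0.le (by linarith)
  have hN : normSq (1 - r * exp (θ * I)) = (1 - r)^2 + r * (2 * (1 - Real.cos θ)) := by
    rw [normSq_apply]
    simp [exp_ofReal_mul_I_re, exp_ofReal_mul_I_im]
    linear_combination r^2 * Real.sin_sq_add_cos_sq θ
  have hN0 : (1 - r)^2 + r * (2 * (1 - Real.cos θ)) ≠ 0 := by positivity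
  rw [inv_re, hN]
  simp only [sub_re, one_re, re_ofReal_mul, exp_ofReal_mul_I_re]
  rw [inv_eq_one_div, div_sub_div _ _ ha.ne' hN0, div_eq_div_iff (by positivity) (by positivity)]
  ring

theorem g_lower {t θ : ℝ} (h0 : 0 < t) (h1 : t ≤ 1/2) (hθ : |θ| ≤ π) :
    (2/π^2*θ^2) / (2 * t * (t^2 + 2/π^2*θ^2)) ≤
      (1 - Real.exp (-t))⁻¹ - ((1 - Real.exp (-t) * exp (θ * I))⁻¹).re := by
  have hr1 : Real.exp (-t) < 1 := by simpa using h0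
  have hr0 : 1/2 ≤ Real.exp (-t) := by linarith [Real.one_sub_le_exp_neg t]
  have hat : 1 - Real.exp (-t) ≤ t := by linarith [Real.one_sub_le_exp_neg t]
  rw [g_eq (Real.exp_pos _) hr1]
  set r := Real.exp (-t)
  have hc := Real.cos_le_one_sub_mul_cos_sq hθ
  set y0 := 2/π^2*θ^2 with hy0
  have hy0n : 0 ≤ y0 := by positivity
  set y := r * (2 * (1 - Real.cos θ)) with hy
  have hyy : y0 ≤ y := by
    have : y0 ≤ 1 - Real.cos θ := by linarith
    nlinarith
  have ha : 0 < 1 - r := by linarith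
  have hyn : 0 ≤ y := hy0n.trans hyy
  calc y0 / (2 * t * (t^2 + y0)) ≤ y / (2 * t * (t^2 + y)) := by
        rw [div_le_div_iff₀ (by positivity) (by positivity)]
        have : 0 ≤ 2 * t^3 * (y - y0) := mul_nonneg (by positivity) (by linarith)
        nlinarith
    _ ≤ y * (1 + r) / (2 * (1 - r) * ((1 - r)^2 + y)) := by
        have h3 : y ≤ y * (1 + r) := by nlinarith
        gcongr

theorem dominate {t u θ : ℝ} (h0 : 0 < t) (h1 : t ≤ 1/2) (hθ : |θ| ≤ π) (hu : θ^2 = t^3 * u^2) :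
    Real.exp (-((1 - Real.exp (-t))⁻¹ - ((1 - Real.exp (-t) * exp (θ * I))⁻¹).re) / 4) ≤
      Real.exp (-(1/(8*π^2)) * u^2) + (12 * 16^4) * (1 + u^2)⁻¹ := by
  have hg := g_lower h0 h1 hθ
  set g := (1 - Real.exp (-t))⁻¹ - ((1 - Real.exp (-t) * exp (θ * I))⁻¹).re
  set c := 2 / π^2 with hc
  have hpi3 := Real.pi_gt_three
  have hpi4 := Real.pi_lt_four
  have hc0 : 0 < c := by positivity
  have hc1 : c < 1 := by
    rw [hc, div_lt_one (by positivity)]; nlinarith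
  rw [hu] at hg
  have e : c * (t^3 * u^2) / (2 * t * (t^2 + c * (t^3 * u^2))) = c * u^2 / (2 * (1 + c * t * u^2)) := by
    rw [div_eq_div_iff (by positivity) (by positivity)]; ring
  rw [e] at hg
  have hv : 0 ≤ u^2 := sq_nonneg u
  rcases le_or_gt (c * t * u^2) 1 with h | h
  · have : c * u^2 / 4 ≤ g := by
      refine le_trans ?_ hg
      have : 0 ≤ c * t * u^2 := by positivity
      apply div_le_div_of_nonneg_left (by positivity) (by positivity)
      linarith
    have h2 : Real.exp (-g/4) ≤ Real.exp (-(1/(8*π^2)) * u^2) := by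
      rw [Real.exp_le_exp]
      have : c = 16 * (1/(8*π^2)) := by rw [hc]; field_simp; norm_num
      nlinarith
    have : 0 ≤ (12 * 16^4) * (1 + u^2)⁻¹ := by positivity
    linarith
  · have hg2 : 1 / (4 * t) ≤ g := by
      refine le_trans ?_ hg
      rw [div_le_div_iff₀ (by positivity) (by positivity)]
      nlinarith
    have hu1 : 1 ≤ u^2 := by
      have : c * t ≤ 1 := by nlinarith
      nlinarith
    have ht3 : t^3 * u^2 ≤ 16 := by
      rw [← hu, ← sq_abs]; nlinarith [abs_nonneg θ]
    have h2 : Real.exp (-g/4) ≤ 6 * 16^3 * t^3 := by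
      have h3 : (1/(16*t)) ^ 3 / 6 ≤ Real.exp (1/(16*t)) := by
        have := Real.pow_div_factorial_le_exp (1/(16*t)) (by positivity) 3
        simpa [Nat.factorial] using this
      have h4 : Real.exp (-g/4) ≤ (Real.exp (1/(16*t)))⁻¹ := by
        rw [← Real.exp_neg, Real.exp_le_exp]
        have : 1/(4*t) = 4 * (1/(16*t)) := by field_simp; norm_num
        linarith
      refine h4.trans ((inv_anti₀ (by positivity) h3).trans (le_of_eq ?_))
      field_simp
    have h5 : t^3 ≤ 2 * 16 * (1 + u^2)⁻¹ := by
      rw [← div_eq_mul_inv, le_div_iff₀ (by positivity)]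
      have : 0 < t^3 := by positivity
      nlinarith
    have := Real.exp_pos (-(1/(8*π^2)) * u^2)
    nlinarith

end OverAsym
namespace OverAsym

open Filter Topology Complex MeasureTheory
open scoped Real

theorem exp_eq_polar (t θ : ℝ) :
    exp (-((t:ℂ) - θ * I)) = (Real.exp (-t) : ℝ) * exp (θ * I) := by
  rw [ofReal_exp, ← exp_add]; congr 1; push_cast; ring

theorem norm_polar (t θ : ℝ) : ‖exp (-((t:ℂ) - θ * I))‖ = Real.exp (-t) := by
  rw [norm_exp]; simp

theorem norm_polar_lt {t : ℝ} (ht : 0 < t) (θ : ℝ) : ‖exp (-((t:ℂ) - θ * I))‖ < 1 := by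
  rw [norm_polar]; simpa using ht

theorem summable_coef {t : ℝ} (ht : 0 < t) :
    Summable fun k : ℕ => (sigmaMex k : ℝ) * Real.exp (-t) ^ k := by
  have := H_summable (norm_polar_lt ht 0)
  refine this.congr fun k => ?_
  rw [norm_mul, norm_pow, norm_polar]; simp

theorem continuous_H {t : ℝ} (ht : 0 < t) :
    Continuous fun θ : ℝ => H (exp (-((t:ℂ) - θ * I))) := by
  have h : (fun θ : ℝ => H (exp (-((t:ℂ) - θ * I)))) =
      fun θ : ℝ => ∑' k : ℕ, (sigmaMex k : ℂ) * exp (-((t:ℂ) - θ * I)) ^ k := by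
    funext θ
    exact (H_hasSum (norm_polar_lt ht θ)).tsum_eq.symm
  rw [h]
  refine continuous_tsum (fun k => by fun_prop) (summable_coef ht) fun k θ => ?_
  rw [norm_mul, norm_pow, norm_polar]; simp

theorem integral_orth (k n : ℕ) :
    ∫ θ in (-π)..π, exp ((((k:ℂ) - n) * I) * (θ:ℂ)) = if k = n then (2 * π : ℂ) else 0 := by
  by_cases h : k = n
  · subst h
    simp
    ring
  · have hne : ((k:ℂ) - n) * I ≠ 0 := by
      refine mul_ne_zero (sub_ne_zero.2 (by exact_mod_cast h)) I_ne_zero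
    rw [if_neg h, integral_exp_mul_complex hne, div_eq_zero_iff]
    left
    rw [sub_eq_zero, exp_eq_exp_iff_exists_int]
    refine ⟨(k:ℤ) - n, ?_⟩
    push_cast
    ring

theorem coeff_int {t : ℝ} (ht : 0 < t) (n : ℕ) :
    ∫ θ in (-π)..π, H (exp (-((t:ℂ) - θ * I))) * exp (-(n * θ * I)) =
      2 * π * (sigmaMex n) * Real.exp (-t) ^ n := by
  have h1 := intervalIntegral.hasSum_integral_of_dominated_convergence (μ := volume)
    (a := -π) (b := π)
    (F := fun (k : ℕ) (θ : ℝ) => (sigmaMex k : ℂ) * exp (-((t:ℂ) - θ * I)) ^ k * exp (-(n * θ * I)))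
    (f := fun θ : ℝ => H (exp (-((t:ℂ) - θ * I))) * exp (-(n * θ * I)))
    (fun k _ => (sigmaMex k : ℝ) * Real.exp (-t) ^ k)
    (fun k => by
      apply Continuous.aestronglyMeasurable
      fun_prop)
    (fun k => Eventually.of_forall fun θ _ => by
      rw [norm_mul, norm_mul, norm_pow, norm_polar, norm_exp (-(n * θ * I))]
      simp)
    (Eventually.of_forall fun θ _ => summable_coef ht)
    (by simp)
    (Eventually.of_forall fun θ _ => (H_hasSum (norm_polar_lt ht θ)).mul_right _)
  have h2 : ∀ k : ℕ, ∫ θ in (-π)..π,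
      (sigmaMex k : ℂ) * exp (-((t:ℂ) - θ * I)) ^ k * exp (-(n * θ * I)) =
      if k = n then (2 * π * (sigmaMex n) * Real.exp (-t) ^ n : ℂ) else 0 := by
    intro k
    have : ∀ θ : ℝ, (sigmaMex k : ℂ) * exp (-((t:ℂ) - θ * I)) ^ k * exp (-(n * θ * I)) =
        (sigmaMex k : ℂ) * (Real.exp (-t) : ℝ) ^ k * exp ((((k:ℂ) - n) * I) * (θ:ℂ)) := by
      intro θ
      have e : exp ((((k:ℂ) - n) * I) * (θ:ℂ)) = exp (θ * I) ^ k * exp (-(n * θ * I)) := by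
        rw [← exp_nat_mul, ← exp_add]
        congr 1
        ring
      rw [exp_eq_polar, mul_pow, e]
      ring
    simp_rw [this]
    rw [intervalIntegral.integral_const_mul, integral_orth]
    split_ifs with hk
    · subst hk; push_cast; ring
    · simp
  simp_rw [h2] at h1
  rw [← h1.tsum_eq, tsum_ite_eq]

/-- The rescaled integrand. -/
noncomputable def F (n : ℕ) (t u : ℝ) : ℂ :=
  H (exp (-((t:ℂ) - (t * √t * u : ℝ) * I))) * exp (-(n * (t * √t * u : ℝ) * I)) *
    (Real.exp (-(π^2/(4*t))) : ℝ)

theorem coeff_rescaled {t : ℝ} (ht : 0 < t) (n : ℕ) :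
    2 * π * (sigmaMex n) * Real.exp (-t) ^ n * (Real.exp (-(π^2/(4*t))) : ℝ) =
    (t * √t : ℝ) * ∫ u : ℝ, (Set.Ioc (-(π / (t * √t))) (π / (t * √t))).indicator (F n t) u := by
  have hs : 0 < t * √t := by positivity
  rw [integral_indicator measurableSet_Ioc,
    ← intervalIntegral.integral_of_le (by
      have : 0 < π / (t * √t) := by positivity
      linarith)]
  unfold F
  rw [intervalIntegral.integral_mul_const]
  have := intervalIntegral.integral_comp_mul_left (a := -(π / (t * √t))) (b := π / (t * √t))
    (fun θ : ℝ => H (exp (-((t:ℂ) - θ * I))) * exp (-(n * θ * I))) hs.ne'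
  rw [this]
  have e1 : t * √t * (π / (t * √t)) = π := by field_simp
  have e2 : t * √t * (-(π / (t * √t))) = -π := by rw [mul_neg, e1]
  rw [e1, e2, coeff_int ht, Complex.real_smul]
  have : ((t * √t : ℝ) : ℂ) ≠ 0 := by exact_mod_cast hs.ne'
  rw [ofReal_inv]
  field_simp

theorem F_eq {n : ℕ} {t : ℝ} (ht : 0 < t) (hn : (n:ℝ) = π^2/(4*t^2)) (u : ℝ) :
    F n t u = J ((t:ℂ) - (t * √t * u : ℝ) * I) *
      exp (-(π^2/4) * (u^2 / (1 - (√t * u : ℝ) * I))) := by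
  have hz : ((t:ℂ) - (t * √t * u : ℝ) * I) = t * (1 - (√t * u : ℝ) * I) := by push_cast; ring
  have hw : (1 - (√t * u : ℝ) * I : ℂ) ≠ 0 := by
    intro h
    have := congrArg Complex.re h
    simp at this
  have ht' : (t:ℂ) ≠ 0 := by exact_mod_cast ht.ne'
  unfold F
  rw [H_eq_J (by simpa using ht), ofReal_exp]
  have hn' : (n:ℂ) = π^2/(4*t^2) := by exact_mod_cast congrArg (fun x : ℝ => (x:ℂ)) hn
  have hsq : ((√t : ℝ) : ℂ)^2 = t := by exact_mod_cast congrArg (fun x : ℝ => (x:ℂ)) (Real.sq_sqrt ht.le)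
  have key : exp (π^2/(4*((t:ℂ) - (t * √t * u : ℝ) * I))) * exp (-(n * (t * √t * u : ℝ) * I)) *
      exp ((-(π^2/(4*t)) : ℝ) : ℂ) = exp (-(π^2/4) * (u^2 / (1 - (√t * u : ℝ) * I))) := by
    rw [← exp_add, ← exp_add, hz, hn']
    congr 1
    push_cast at hw ⊢
    field_simp
    have hI := I_sq
    generalize hb : ((√t : ℝ) : ℂ) = b at *
    rw [← hsq]
    linear_combination b^2 * u^2 * hI
  rw [← key]
  ring



theorem F_tendsto {t : ℕ → ℝ} (ht0 : Tendsto t atTop (𝓝 0)) (hpos : ∀ᶠ n in atTop, 0 < t n)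
    (hn : ∀ᶠ n : ℕ in atTop, (n:ℝ) = π^2/(4*(t n)^2)) (u : ℝ) :
    Tendsto (fun n => F n (t n) u) atTop (𝓝 (c0 * Real.exp (-(π^2/4) * u^2) : ℝ)) := by
  have hst : Tendsto (fun n => √(t n)) atTop (𝓝 0) := by
    simpa [Function.comp_def] using (Real.continuous_sqrt.tendsto 0).comp ht0
  have hsu : Tendsto (fun n => ((√(t n) * u : ℝ) : ℂ)) atTop (𝓝 0) := by
    have := (continuous_ofReal.tendsto _).comp (hst.mul_const u)
    simpa [Function.comp_def] using this
  have hw : Tendsto (fun n => (1 - ((√(t n) * u : ℝ) : ℂ) * I)) atTop (𝓝 1) := by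
    simpa using (hsu.mul_const I).const_sub 1
  have htc : Tendsto (fun n => ((t n : ℝ) : ℂ)) atTop (𝓝 0) := by
    simpa [Function.comp_def] using (continuous_ofReal.tendsto _).comp ht0
  have hz : ∀ n, ((t n:ℂ) - (t n * √(t n) * u : ℝ) * I) = t n * (1 - (√(t n) * u : ℝ) * I) := by
    intro n; push_cast; ring
  have hwinv : Tendsto (fun n => (1 - ((√(t n) * u : ℝ) : ℂ) * I)⁻¹) atTop (𝓝 1) := by
    simpa using hw.inv₀ one_ne_zero
  have hJ : Tendsto (fun n => J ((t n:ℂ) - (t n * √(t n) * u : ℝ) * I)) atTop (𝓝 (c0:ℂ)) := by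
    refine tendsto_J ?_ ?_
    · simp_rw [hz]
      simpa using htc.mul hw
    · simp_rw [hz, mul_inv, ← ofReal_inv, re_ofReal_mul]
      have h1 : Tendsto (fun n => (t n)⁻¹) atTop atTop :=
        tendsto_inv_nhdsGT_zero.comp (tendsto_nhdsWithin_iff.2 ⟨ht0, hpos⟩)
      have h2 := (continuous_re.tendsto _).comp hwinv
      rw [one_re] at h2
      exact h1.atTop_mul_pos one_pos h2
  have hE : Tendsto (fun n => exp (-(π^2/4) * (u^2 / (1 - (√(t n) * u : ℝ) * I)))) atTop
      (𝓝 (exp (-(π^2/4) * u^2))) := by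
    refine (continuous_exp.tendsto _).comp ?_
    have := (hwinv.const_mul ((u:ℂ)^2)).const_mul (-((π:ℂ)^2/4))
    simpa [div_eq_mul_inv] using this
  have h := hJ.mul hE
  have e : ((c0 * Real.exp (-(π^2/4) * u^2) : ℝ) : ℂ) = c0 * exp (-(π^2/4) * u^2) := by
    push_cast; rfl
  rw [e]
  refine h.congr' ?_
  filter_upwards [hpos, hn] with n h1 h2
  rw [F_eq h1 h2]

theorem F_bound {t u : ℝ} (n : ℕ) (h0 : 0 < t) (h1 : t ≤ 1/2) (hθ : |t * √t * u| ≤ π) :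
    ‖F n t u‖ ≤ ‖J t‖ * (Real.exp (-(1/(8*π^2)) * u^2) + (12 * 16^4) * (1 + u^2)⁻¹) := by
  have hu : (t * √t * u)^2 = t^3 * u^2 := by
    rw [mul_pow, mul_pow, Real.sq_sqrt h0.le]; ring
  have hd := dominate h0 h1 hθ hu
  have hb := H_bound (norm_polar_lt h0 (t * √t * u))
  rw [norm_polar, exp_eq_polar] at hb
  have hH : H ((Real.exp (-t) : ℝ) : ℂ) = exp (π^2/(4*t)) * J t := by
    rw [ofReal_exp, ofReal_neg]; exact H_eq_J (by simpa using h0)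
  unfold F
  rw [norm_mul, norm_mul, exp_eq_polar, Complex.norm_real, Real.norm_of_nonneg (Real.exp_pos _).le,
    norm_exp (-(n * (t * √t * u : ℝ) * I))]
  have e1 : (-(n * (t * √t * u : ℝ) * I)).re = 0 := by
    have : (-(n * (t * √t * u : ℝ) * I)) = ((-(n * (t * √t * u)) : ℝ) : ℂ) * I := by push_cast; ring
    rw [this, re_ofReal_mul, I_re, mul_zero]
  have e2 : ‖exp ((π:ℂ)^2/(4*t))‖ = Real.exp (π^2/(4*t)) := by
    have : exp ((π:ℂ)^2/(4*t)) = ((Real.exp (π^2/(4*t)) : ℝ) : ℂ) := by push_cast; rfl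
    rw [this, Complex.norm_real, Real.norm_of_nonneg (Real.exp_pos _).le]
  rw [hH, norm_mul, e2] at hb
  rw [e1, Real.exp_zero, mul_one]
  have e3 : Real.exp (π^2/(4*t)) * Real.exp (-(π^2/(4*t))) = 1 := by
    rw [← Real.exp_add]; simp
  calc _ ≤ (Real.exp (π^2/(4*t)) * ‖J t‖ * _) * Real.exp (-(π^2/(4*t))) := by gcongr
    _ ≤ (Real.exp (π^2/(4*t)) * ‖J t‖ * (Real.exp (-(1/(8*π^2)) * u^2) + (12 * 16^4) * (1 + u^2)⁻¹)) *
        Real.exp (-(π^2/(4*t))) := by gcongr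
    _ = _ := by linear_combination (‖J t‖ * (Real.exp (-(1/(8*π^2)) * u^2) + (12 * 16^4) * (1 + u^2)⁻¹)) * e3

theorem continuous_F {n : ℕ} {t : ℝ} (ht : 0 < t) : Continuous (F n t) := by
  unfold F
  have h1 : Continuous fun u : ℝ => t * √t * u := by fun_prop
  have h := (continuous_H ht).comp h1
  simp only [Function.comp_def] at h
  refine (h.mul ?_).mul continuous_const
  fun_prop

theorem tendsto_integral {t : ℕ → ℝ} (ht0 : Tendsto t atTop (𝓝 0)) (hpos : ∀ᶠ n in atTop, 0 < t n)
    (hn : ∀ᶠ n : ℕ in atTop, (n:ℝ) = π^2/(4*(t n)^2)) :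
    Tendsto (fun n => ∫ u : ℝ, (Set.Ioc (-(π / (t n * √(t n)))) (π / (t n * √(t n)))).indicator
      (F n (t n)) u) atTop (𝓝 (c0 * √(π / (π^2/4)) : ℝ)) := by
  have e : ((c0 * √(π / (π^2/4)) : ℝ) : ℂ) =
      ∫ u : ℝ, ((c0 * Real.exp (-(π^2/4) * u^2) : ℝ) : ℂ) := by
    rw [integral_complex_ofReal, integral_const_mul, integral_gaussian]
  rw [e]
  have hJ : Tendsto (fun n => J (t n)) atTop (𝓝 (c0:ℂ)) := by
    refine tendsto_J ?_ ?_
    · simpa [Function.comp_def] using (continuous_ofReal.tendsto _).comp ht0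
    · simp_rw [← ofReal_inv, ofReal_re]
      exact tendsto_inv_nhdsGT_zero.comp (tendsto_nhdsWithin_iff.2 ⟨ht0, hpos⟩)
  have hJb : ∀ᶠ n in atTop, ‖J (t n)‖ ≤ ‖(c0:ℂ)‖ + 1 :=
    (hJ.norm.eventually (gt_mem_nhds (lt_add_one _))).mono fun n h => h.le
  have hs0 : Tendsto (fun n => t n * √(t n)) atTop (𝓝 0) := by
    have := ht0.mul ((Real.continuous_sqrt.tendsto 0).comp ht0)
    simpa using this
  refine tendsto_integral_filter_of_dominated_convergence
    (fun u => (‖(c0:ℂ)‖ + 1) * (Real.exp (-(1/(8*π^2)) * u^2) + (12 * 16^4) * (1 + u^2)⁻¹))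
    ?_ ?_ ?_ ?_
  · filter_upwards [hpos] with n h
    exact (continuous_F h).aestronglyMeasurable.indicator measurableSet_Ioc
  · filter_upwards [hpos, hJb, ht0.eventually (gt_mem_nhds (by norm_num : (0:ℝ) < 1/2))] with n h1 h2 h3
    refine Eventually.of_forall fun u => ?_
    by_cases hu : u ∈ Set.Ioc (-(π / (t n * √(t n)))) (π / (t n * √(t n)))
    · rw [Set.indicator_of_mem hu]
      have hs : 0 < t n * √(t n) := by positivity
      refine (F_bound n h1 h3.le ?_).trans ?_
      · rw [abs_mul, abs_of_pos hs, ← le_div_iff₀' hs]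
        exact abs_le.2 ⟨hu.1.le, hu.2⟩
      · gcongr
    · rw [Set.indicator_of_notMem hu]
      simp only [norm_zero]
      positivity
  · refine Integrable.const_mul (Integrable.add ?_ ?_) _
    · exact integrable_exp_neg_mul_sq (by positivity)
    · exact integrable_inv_one_add_sq.const_mul _
  · refine Eventually.of_forall fun u => ?_
    refine (F_tendsto ht0 hpos hn u).congr' ?_
    have : Tendsto (fun n => t n * √(t n) * |u|) atTop (𝓝 0) := by
      simpa using hs0.mul_const |u|
    filter_upwards [hpos, this.eventually (gt_mem_nhds Real.pi_pos)] with n h1 h2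
    have hs : 0 < t n * √(t n) := by positivity
    rw [Set.indicator_of_mem]
    have h3 : |u| < π / (t n * √(t n)) := by rwa [lt_div_iff₀' hs]
    exact ⟨(abs_lt.1 h3).1, (abs_lt.1 h3).2.le⟩

theorem const_eq : 8 * (π/2 * √(π/2)) * (c0 * √(π / (π^2/4))) / (2 * π) = 1 := by
  have hpi := Real.pi_pos
  have h1 : √(π/2) * √(π / (π^2/4)) = √2 := by
    rw [← Real.sqrt_mul (by positivity)]
    congr 1
    field_simp
    norm_num
  have h2 : c0 * √2 = 1/2 := by
    have : √2 = Real.exp (Real.log 2 / 2) := by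
      rw [Real.exp_half, Real.exp_log (by norm_num)]
    rw [c0, this, mul_assoc, ← Real.exp_add]
    simp
  have h3 : 8 * (π/2 * √(π/2)) * (c0 * √(π / (π^2/4))) / (2 * π) =
      8 * (π/2) * (c0 * (√(π/2) * √(π / (π^2/4)))) / (2 * π) := by ring
  rw [h3, h1, h2]
  field_simp
  norm_num

theorem main :
    Tendsto (fun n : ℕ =>
        (sigmaMex n : ℝ) / (Real.exp (Real.pi * Real.sqrt n) / (8 * (n : ℝ) ^ (3 / 4 : ℝ))))
      atTop (nhds 1) := by
  set t : ℕ → ℝ := fun n => π / (2 * √n) with htdef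
  have hsq : Tendsto (fun n : ℕ => √(n:ℝ)) atTop atTop :=
    Real.tendsto_sqrt_atTop.comp tendsto_natCast_atTop_atTop
  have ht0 : Tendsto t atTop (𝓝 0) :=
    (hsq.const_mul_atTop (by norm_num : (0:ℝ) < 2)).const_div_atTop π
  have hpos : ∀ᶠ n in atTop, 0 < t n := by
    filter_upwards [eventually_gt_atTop 0] with n hn
    have : (0:ℝ) < n := by exact_mod_cast hn
    simp only [htdef]
    positivity
  have hn : ∀ᶠ n : ℕ in atTop, (n:ℝ) = π^2/(4*(t n)^2) := by
    filter_upwards [eventually_gt_atTop 0] with n hn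
    have h : (0:ℝ) < n := by exact_mod_cast hn
    have h1 : √(n:ℝ)^2 = n := Real.sq_sqrt h.le
    have h2 : 0 < √(n:ℝ) := Real.sqrt_pos.2 h
    simp only [htdef]
    field_simp
    rw [h1]; ring
  have hI := (continuous_re.tendsto _).comp (tendsto_integral ht0 hpos hn)
  rw [ofReal_re] at hI
  have h := (hI.const_mul (8 * (π/2 * √(π/2)))).div_const (2 * π)
  rw [const_eq] at h
  refine h.congr' ?_
  filter_upwards [hpos, eventually_gt_atTop 0] with n h1 hn0
  have hc := congrArg Complex.re (coeff_rescaled h1 n)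
  rw [re_ofReal_mul] at hc
  simp only [Function.comp]
  set K := (∫ u : ℝ, (Set.Ioc (-(π / (t n * √(t n)))) (π / (t n * √(t n)))).indicator
      (F n (t n)) u).re
  have e0 : (2 * π * (sigmaMex n) * Real.exp (-(t n)) ^ n * (Real.exp (-(π^2/(4*t n))) : ℝ) : ℂ) =
      ((2 * π * (sigmaMex n) * Real.exp (-(t n)) ^ n * (Real.exp (-(π^2/(4*t n)))) : ℝ) : ℂ) := by
    push_cast; rfl
  rw [e0, ofReal_re] at hc
  have h : (0:ℝ) < n := by exact_mod_cast hn0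
  set m := √(n:ℝ) with hm
  have hm0 : 0 < m := Real.sqrt_pos.2 h
  have hnm : (n:ℝ) = m^2 := (Real.sq_sqrt h.le).symm
  have htm : t n = π / (2 * m) := rfl
  have e1 : Real.exp (-(t n)) ^ n * Real.exp (-(π^2/(4*t n))) = Real.exp (-(π * m)) := by
    rw [← Real.exp_nat_mul, ← Real.exp_add, htm, hnm]
    congr 1
    field_simp
    ring
  have e2 : (n:ℝ) ^ (3/4 : ℝ) = m * √m := by
    rw [hnm, ← Real.rpow_natCast, ← Real.rpow_mul hm0.le, Real.sqrt_eq_rpow]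
    nth_rewrite 2 [← Real.rpow_one m]
    rw [← Real.rpow_add hm0]
    norm_num
  have e3 : (m * √m) * (t n * √(t n)) = π/2 * √(π/2) := by
    have : √m * √(t n) = √(π/2) := by
      rw [← Real.sqrt_mul hm0.le, htm]; congr 1; field_simp
    calc _ = (m * t n) * (√m * √(t n)) := by ring
      _ = _ := by rw [this, htm]; congr 1; field_simp
  rw [mul_assoc, e1] at hc
  rw [e2, ← e3]
  have e4 : Real.exp (-(π * m)) * Real.exp (π * m) = 1 := by
    rw [← Real.exp_add]; simp
  have hpi := Real.pi_pos
  have hE := Real.exp_pos (π * m)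
  have hsm : 0 < √m := Real.sqrt_pos.2 hm0
  have e5 : (sigmaMex n : ℝ) = (t n * √(t n) * K) * Real.exp (π * m) / (2 * π) := by
    rw [← hc, eq_div_iff (by positivity)]
    linear_combination (-(2 * π * (sigmaMex n : ℝ))) * e4
  rw [e5]
  field_simp

end OverAsym
open Filter

/-- σmex̄(n) ~ e^{π√n} / (8 n^{3/4}) as n → ∞. -/
theorem stmt16 :
    Tendsto (fun n : ℕ =>
        (sigmaMex n : ℝ) / (Real.exp (Real.pi * Real.sqrt n) / (8 * (n : ℝ) ^ (3 / 4 : ℝ))))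
      atTop (nhds 1) := by
  exact OverAsym.main
end

section
/- As t → 0⁺, the product ∏_{n≥1}(1 + e^{−nt}) is asymptotic to (1/√2) · e^{π²/(12t)}. -/
open Filter

/-- The real Euler product `∏_{n ≥ 1} (1 - e^{-ns})`. -/
noncomputable def eulerP (s : ℝ) : ℝ := ∏' n : ℕ, (1 - Real.exp (-s) ^ (n + 1))

lemma aux_summable {s : ℝ} (hs : 0 < s) : Summable fun n : ℕ => Real.exp (-s) ^ (n + 1) := by
  have h : Real.exp (-s) < 1 := by simpa using hs
  simpa only [pow_succ'] using
    (summable_geometric_of_lt_one (Real.exp_pos _).le h).mul_left (Real.exp (-s))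

lemma aux_multipliable {s : ℝ} (hs : 0 < s) :
    Multipliable fun n : ℕ => (1 - Real.exp (-s) ^ (n + 1)) := by
  simpa only [sub_eq_add_neg] using
    Real.multipliable_one_add_of_summable (aux_summable hs).neg

lemma aux_multipliable' {s : ℝ} (hs : 0 < s) :
    Multipliable fun n : ℕ => (1 + Real.exp (-s) ^ (n + 1)) :=
  Real.multipliable_one_add_of_summable (aux_summable hs)

lemma eulerP_ne_zero {s : ℝ} (hs : 0 < s) : eulerP s ≠ 0 := by
  unfold eulerP
  simp only [sub_eq_add_neg]
  refine tprod_one_add_ne_zero_of_summable (f := fun n : ℕ => -Real.exp (-s) ^ (n + 1)) ?_ ?_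
  · intro n
    have h : Real.exp (-s) < 1 := by simpa using hs
    have := pow_lt_one₀ (Real.exp_pos (-s)).le h (Nat.succ_ne_zero n)
    simp only [Nat.succ_eq_add_one] at this
    linarith
  · simpa using aux_summable hs

lemma eulerP_nonneg {s : ℝ} (hs : 0 < s) : 0 ≤ eulerP s := by
  refine ge_of_tendsto' (aux_multipliable hs).hasProd fun F => Finset.prod_nonneg fun n _ => ?_
  have h : Real.exp (-s) ≤ 1 := by simpa using hs.le
  have := pow_le_one₀ (n := n + 1) (Real.exp_pos (-s)).le h
  linarith

lemma eulerP_two_mul {t : ℝ} (ht : 0 < t) :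
    ∏' n : ℕ, (1 + Real.exp (-((n : ℝ) + 1) * t)) = eulerP (2 * t) / eulerP t := by
  rw [eq_div_iff (eulerP_ne_zero ht)]
  have h1 : ∀ n : ℕ, Real.exp (-((n : ℝ) + 1) * t) = Real.exp (-t) ^ (n + 1) := by
    intro n
    rw [← Real.exp_nat_mul]
    congr 1
    push_cast
    ring
  simp only [h1]
  unfold eulerP
  rw [← (aux_multipliable' ht).tprod_mul (aux_multipliable ht)]
  refine tprod_congr fun n => ?_
  have : Real.exp (-(2 * t)) = Real.exp (-t) ^ 2 := by
    rw [← Real.exp_nat_mul]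
    congr 1
    push_cast
    ring
  rw [this]
  ring

lemma eulerP_tendsto : Tendsto eulerP atTop (nhds 1) := by
  have htprod : Tendsto (fun q : ℝ ↦ ∏' (n : ℕ), (1 - q ^ (n + 1))) (nhds 0) (nhds 1) := by
    have := tendsto_tprod_one_add_of_dominated_convergence (𝓕 := nhds 0) (g := 0)
      (f := fun (q : ℝ) (n : ℕ) ↦ -q ^ (n + 1)) (bound := fun n ↦ (1 / 2 : ℝ) ^ (n + 1))
    simp only [Pi.zero_apply, norm_neg, norm_pow, add_zero, tprod_one] at this
    simp_rw [sub_eq_add_neg]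
    refine this
      (by simpa only [pow_succ'] using (summable_geometric_of_abs_lt_one (by norm_num)).mul_left _)
      (fun k ↦ by simpa using ((continuous_pow (M := ℝ) (k + 1)).tendsto 0).neg) ?_
    filter_upwards [Metric.ball_mem_nhds (0 : ℝ) (by norm_num : (0 : ℝ) < 1 / 2)] with q hq k
    exact pow_le_pow_left₀ (norm_nonneg _) (mem_ball_zero_iff.mp hq).le _
  exact htprod.comp Real.tendsto_exp_neg_atTop_nhds_zero

lemma norm_eta {y : ℝ} (hy : 0 < y) :
    ‖ModularForm.eta (y * Complex.I)‖ =
      Real.exp (-(Real.pi * y / 12)) * eulerP (2 * Real.pi * y) := by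
  have hs : 0 < 2 * Real.pi * y := by positivity
  unfold ModularForm.eta
  rw [norm_mul]
  congr 1
  · rw [Function.Periodic.qParam, Complex.norm_exp]
    congr 1
    have : (2 * Real.pi * Complex.I * (y * Complex.I) / (24 : ℝ) : ℂ)
        = ((-(Real.pi * y / 12) : ℝ) : ℂ) := by
      push_cast
      linear_combination (2 * Real.pi * y / 24 : ℂ) * Complex.I_sq
    rw [this, Complex.ofReal_re]
  · have h : ∏' n : ℕ, (1 - ModularForm.eta_q n (y * Complex.I))
        = ((eulerP (2 * Real.pi * y) : ℝ) : ℂ) := by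
      unfold eulerP
      have := (aux_multipliable hs).map_tprod Complex.ofRealHom Complex.continuous_ofReal
      simp only [Complex.ofRealHom_eq_coe] at this
      rw [this]
      refine tprod_congr fun n => ?_
      rw [ModularForm.eta_q_eq_pow]
      push_cast
      congr 3
      linear_combination (2 * Real.pi * y : ℂ) * Complex.I_sq
    rw [h, Complex.norm_real, Real.norm_of_nonneg (eulerP_nonneg hs)]

lemma norm_csqrt (z : ℂ) (hz : z ≠ 0) : ‖Complex.sqrt z‖ = Real.sqrt ‖z‖ := by
  have : Complex.sqrt z ^ 2 = z := by
    rw [Complex.sqrt]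
    exact_mod_cast Complex.cpow_nat_inv_pow z two_ne_zero
  rw [eq_comm, Real.sqrt_eq_iff_mul_self_eq (norm_nonneg _) (norm_nonneg _)]
  rw [← norm_mul, ← sq, this]

lemma eulerP_transform {t : ℝ} (ht : 0 < t) :
    eulerP t = Real.exp (t / 24) * Real.sqrt (2 * Real.pi / t) *
      Real.exp (-(Real.pi ^ 2 / (6 * t))) * eulerP (4 * Real.pi ^ 2 / t) := by
  have hpi := Real.pi_pos
  have hy : 0 < 2 * Real.pi / t := by positivity
  have hyy : 0 < t / (2 * Real.pi) := by positivity
  have h := ModularForm.eta_comp_eq_csqrt_I_inv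
    (show (((2 * Real.pi / t : ℝ) : ℂ) * Complex.I) ∈ UpperHalfPlane.upperHalfPlaneSet by
      show 0 < (((2 * Real.pi / t : ℝ) : ℂ) * Complex.I).im
      simpa using hy)
  have hz : (-1 / (((2 * Real.pi / t : ℝ) : ℂ) * Complex.I)) =
      ((t / (2 * Real.pi) : ℝ) : ℂ) * Complex.I := by
    have h1 : (t : ℂ) ≠ 0 := by exact_mod_cast ht.ne'
    have h2 : (Real.pi : ℂ) ≠ 0 := by exact_mod_cast hpi.ne'
    have h3 := Complex.I_ne_zero
    push_cast
    field_simp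
    rw [Complex.I_sq]
  simp only [Function.comp_apply, Pi.smul_apply, Pi.mul_apply, smul_eq_mul] at h
  rw [hz] at h
  have hnorm := congrArg norm h
  rw [norm_mul, norm_mul, norm_inv, norm_csqrt _ Complex.I_ne_zero,
    norm_csqrt _ (mul_ne_zero (by exact_mod_cast hy.ne') Complex.I_ne_zero), norm_eta hy,
    norm_eta hyy, norm_mul, Complex.norm_real, Complex.norm_I, Real.norm_of_nonneg hy.le,
    Real.sqrt_one, inv_one, one_mul, mul_one] at hnorm
  have e1 : 2 * Real.pi * (t / (2 * Real.pi)) = t := by field_simp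
  have e2 : 2 * Real.pi * (2 * Real.pi / t) = 4 * Real.pi ^ 2 / t := by ring
  have e3 : Real.pi * (t / (2 * Real.pi)) / 12 = t / 24 := by field_simp; norm_num
  have e4 : Real.pi * (2 * Real.pi / t) / 12 = Real.pi ^ 2 / (6 * t) := by field_simp; norm_num
  rw [e1, e2, e3, e4] at hnorm
  have h5 : Real.exp (t / 24) * Real.exp (-(t / 24)) = 1 := by
    rw [← Real.exp_add]; simp
  calc eulerP t = Real.exp (t / 24) * (Real.exp (-(t / 24)) * eulerP t) := by
        rw [← mul_assoc, h5, one_mul]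
    _ = _ := by rw [hnorm]; ring

/-- As t → 0⁺, ∏_{n≥1}(1 + e^{−nt}) ~ (1/√2)·e^{π²/(12t)}. -/
theorem stmt17 :
    Tendsto (fun t : ℝ =>
        (∏' n : ℕ, (1 + Real.exp (-((n : ℝ) + 1) * t))) /
          ((1 / Real.sqrt 2) * Real.exp (Real.pi ^ 2 / (12 * t))))
      (nhdsWithin 0 (Set.Ioi 0)) (nhds 1) := by
  have hpi := Real.pi_pos
  have key : ∀ c : ℝ, 0 < c →
      Tendsto (fun t : ℝ => eulerP (c / t)) (nhdsWithin 0 (Set.Ioi 0)) (nhds 1) := by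
    intro c hc
    refine eulerP_tendsto.comp ?_
    exact (tendsto_inv_nhdsGT_zero.const_mul_atTop hc).congr fun t => (div_eq_mul_inv c t).symm
  have hexp : Tendsto (fun t : ℝ => Real.exp (t / 24)) (nhdsWithin 0 (Set.Ioi 0)) (nhds 1) := by
    have : Continuous fun t : ℝ => Real.exp (t / 24) := by fun_prop
    simpa using (this.tendsto 0).mono_left nhdsWithin_le_nhds
  have hlim := hexp.mul ((key (2 * Real.pi ^ 2) (by positivity)).div
    (key (4 * Real.pi ^ 2) (by positivity)) one_ne_zero)
  rw [div_one, mul_one] at hlim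
  refine hlim.congr' ?_
  filter_upwards [self_mem_nhdsWithin] with t ht
  have ht : 0 < t := ht
  have hP : eulerP (4 * Real.pi ^ 2 / t) ≠ 0 := eulerP_ne_zero (by positivity)
  rw [eulerP_two_mul ht, eulerP_transform ht, eulerP_transform (t := 2 * t) (by positivity)]
  have e1 : 4 * Real.pi ^ 2 / (2 * t) = 2 * Real.pi ^ 2 / t := by field_simp; norm_num
  have e2 : Real.sqrt (2 * Real.pi / t) = Real.sqrt 2 * Real.sqrt (2 * Real.pi / (2 * t)) := by
    rw [← Real.sqrt_mul (by norm_num)]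
    congr 1
    field_simp
  have e3 : Real.exp (-(Real.pi ^ 2 / (6 * (2 * t)))) =
      Real.exp (-(Real.pi ^ 2 / (6 * t))) * Real.exp (Real.pi ^ 2 / (12 * t)) := by
    rw [← Real.exp_add]
    congr 1
    field_simp
    norm_num
  have e4 : Real.exp (2 * t / 24) = Real.exp (t / 24) * Real.exp (t / 24) := by
    rw [← Real.exp_add]
    congr 1
    ring
  rw [e1, e2, e3, e4]
  simp only [Pi.div_apply]
  have n1 : Real.sqrt 2 ≠ 0 := by positivity
  have n2 : Real.sqrt (2 * Real.pi / (2 * t)) ≠ 0 := by positivity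
  have n3 := Real.exp_ne_zero (t / 24)
  have n4 := Real.exp_ne_zero (-(Real.pi ^ 2 / (6 * t)))
  have n5 := Real.exp_ne_zero (Real.pi ^ 2 / (12 * t))
  generalize Real.sqrt (2 * Real.pi / (2 * t)) = A at *
  generalize Real.exp (t / 24) = B at *
  generalize Real.exp (-(Real.pi ^ 2 / (6 * t))) = C at *
  generalize Real.exp (Real.pi ^ 2 / (12 * t)) = D at *
  generalize eulerP (4 * Real.pi ^ 2 / t) = E at *
  generalize eulerP (2 * Real.pi ^ 2 / t) = F at *
  field_simp
end
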